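/- arXiv:1706.01928 — 4 statements merged into one kernel-verified Lean document; each statement's English description precedes it below -/
import Mathlib

section
/- Let α > 0, let f : (0,∞) → ℝ be smooth with compact support contained in (0,∞), and let x > 0. Then for ν = 0 the fractional Bessel integral reduces to the Liouville fractional integral of order 2α: (IB_{0,-}^α f)(x) = (1/Γ(2α)) ∫_x^∞ (y − x)^{2α−1} f(y) dy. -/
open MeasureTheory Set

/-- Gauss hypergeometric function ₂F₁(a,b;c;z) defined by its power series. -/
noncomputable def gaussHyp (a b c z : ℝ) : ℝ :=
  ∑' n : ℕ, ((ascPochhammer ℝ n).eval a * (ascPochhammer ℝ n).eval b /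
    ((ascPochhammer ℝ n).eval c * (n.factorial : ℝ))) * z ^ n

/-- Fractional Bessel integral on the semiaxis. -/
noncomputable def IB (ν α : ℝ) (f : ℝ → ℝ) (x : ℝ) : ℝ :=
  (1 / Real.Gamma (2 * α)) *
    ∫ y in Ioi x, ((y ^ 2 - x ^ 2) / (2 * y)) ^ (2 * α - 1) *
      gaussHyp (α + (ν - 1) / 2) α (2 * α) (1 - x ^ 2 / y ^ 2) * f y

theorem ode_iter (g : ℂ → ℂ) (a b c : ℂ) (hg : DifferentiableOn ℂ g (Metric.ball 0 1))
  (h : ∀ z ∈ Metric.ball (0:ℂ) 1, z*(1-z)*deriv (deriv g) z + (c-(a+b+1)*z)*deriv g z - a*b*g z = 0) (n : ℕ) :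
  ∀ z ∈ Metric.ball (0:ℂ) 1, z*(1-z)*iteratedDeriv (n+2) g z + (c+n-(a+b+1+2*n)*z)*iteratedDeriv (n+1) g z - (a+n)*(b+n)*iteratedDeriv n g z = 0 := by
  have ha : ∀ (n:ℕ), ∀ z ∈ Metric.ball (0:ℂ) 1, HasDerivAt (iteratedDeriv n g) (iteratedDeriv (n+1) g z) z := by
    intro n z hz
    have h1 : AnalyticAt ℂ (iteratedDeriv n g) z := by
      have := (hg.analyticOnNhd Metric.isOpen_ball).iterated_deriv n z hz
      rwa [← iteratedDeriv_eq_iterate] at this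
    rw [iteratedDeriv_succ]
    exact h1.differentiableAt.hasDerivAt
  induction n with
  | zero =>
    intro z hz
    have := h z hz
    simp only [iteratedDeriv_succ, iteratedDeriv_zero]
    push_cast
    linear_combination this
  | succ n ih =>
    intro z hz
    have e : (fun z => z*(1-z)*iteratedDeriv (n+2) g z + (c+n-(a+b+1+2*n)*z)*iteratedDeriv (n+1) g z - (a+n)*(b+n)*iteratedDeriv n g z) =ᶠ[nhds z] fun _ => 0 := by
      filter_upwards [Metric.isOpen_ball.mem_nhds hz] with w hw using ih w hw
    have d1 := (((hasDerivAt_id' z).mul ((hasDerivAt_id' z).const_sub 1)).mul (ha (n+2) z hz)).add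
      ((((hasDerivAt_id' z).const_mul (a+b+1+2*n)).const_sub (c+n)).mul (ha (n+1) z hz))
    have d2 := d1.sub ((ha n z hz).const_mul ((a+n)*(b+n)))
    have d3 := d2.unique ((hasDerivAt_const z (0:ℂ)).congr_of_eventuallyEq e)
    push_cast
    simp only [Pi.mul_apply] at d3
    linear_combination d3

theorem coeff (g : ℂ → ℂ) (a b c : ℝ) (hc : 0 < c) (hg : DifferentiableOn ℂ g (Metric.ball 0 1))
  (h : ∀ z ∈ Metric.ball (0:ℂ) 1, z*(1-z)*deriv (deriv g) z + (c-(a+b+1)*z)*deriv g z - a*b*g z = 0) (h0 : g 0 = 1) (n : ℕ) :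
  iteratedDeriv n g 0 = (((ascPochhammer ℝ n).eval a * (ascPochhammer ℝ n).eval b / (ascPochhammer ℝ n).eval c : ℝ) : ℂ) := by
  induction n with
  | zero => simp [h0]
  | succ n ih =>
    have := ode_iter g a b c hg h n 0 (by simp)
    rw [ih] at this
    have hp : (ascPochhammer ℝ n).eval c ≠ 0 := (ascPochhammer_pos n c hc).ne'
    have hcn : (c + n) ≠ 0 := by positivity
    have hp' : (((ascPochhammer ℝ n).eval c : ℝ) : ℂ) ≠ 0 := by exact_mod_cast hp
    have hcn' : (c + n : ℂ) ≠ 0 := by exact_mod_cast hcn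
    simp only [ascPochhammer_succ_eval]
    push_cast at this ⊢
    have h2 : (c+n:ℂ) * iteratedDeriv (n+1) g 0 = (a+n)*(b+n)*(((ascPochhammer ℝ n).eval a:ℝ) * ((ascPochhammer ℝ n).eval b:ℝ) / ((ascPochhammer ℝ n).eval c:ℝ)) := by
      linear_combination this
    apply mul_left_cancel₀ hcn'
    rw [h2]
    field_simp

theorem gh (g : ℂ → ℂ) (a b c : ℝ) (hc : 0 < c) (hg : DifferentiableOn ℂ g (Metric.ball 0 1))
  (h : ∀ z ∈ Metric.ball (0:ℂ) 1, z*(1-z)*deriv (deriv g) z + (c-(a+b+1)*z)*deriv g z - a*b*g z = 0) (h0 : g 0 = 1)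
  (z : ℝ) (hz0 : 0 < z) (hz : z < 1) (G : ℝ) (hG : g z = G) :
  ∑' n : ℕ, ((ascPochhammer ℝ n).eval a * (ascPochhammer ℝ n).eval b /
    ((ascPochhammer ℝ n).eval c * (n.factorial : ℝ))) * z ^ n = G := by
  have hb : (z:ℂ) ∈ Metric.ball (0:ℂ) 1 := by simp [abs_of_pos hz0, hz]
  have := Complex.hasSum_taylorSeries_on_ball hg hb
  rw [hG] at this
  apply HasSum.tsum_eq
  rw [← Complex.hasSum_ofReal]
  refine Eq.mp (congrArg (fun u : ℕ → ℂ => HasSum u (G:ℂ)) (funext fun n => ?_)) this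
  symm
  rw [coeff g a b c hc hg h h0]
  simp only [smul_eq_mul]
  push_cast
  simp only [sub_zero, div_eq_mul_inv, mul_inv]
  ring

theorem gder (a : ℂ) (z : ℂ) (hz : z ∈ Metric.ball (0:ℂ) 1) :
   ∃ s : ℂ, s = (1-z)^(1/2:ℂ) ∧ s^2 = 1-z ∧ s ≠ 0 ∧ 1 + s ≠ 0 ∧ HasDerivAt (fun z:ℂ => (1-z)^(1/2:ℂ)) (-1/(2*s)) z ∧
   HasDerivAt (fun z : ℂ => ((1+(1-z)^(1/2:ℂ))/2)^(-2*a)) (a * ((1+(1-z)^(1/2:ℂ))/2)^(-2*a) / (s*(1+s))) z := by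
  have hre : 0 < (1-z).re := by
    have h1 : ‖z‖ < 1 := by simpa using hz
    have := Complex.re_le_norm z
    simp; linarith
  have hsl : 1 - z ∈ Complex.slitPlane := Or.inl hre
  have hne : 1 - z ≠ 0 := Complex.slitPlane_ne_zero hsl
  obtain ⟨s, hs⟩ : ∃ s, s = (1-z)^(1/2:ℂ) := ⟨_, rfl⟩
  have hs2 : s^2 = 1-z := by
    rw [hs, ← Complex.cpow_nat_mul]; simp
  have hs0 : s ≠ 0 := by
    rintro rfl; simp at hs2; exact hne hs2.symm
  have hspos : 0 ≤ s.re := by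
    rw [hs, Complex.cpow_def_of_ne_zero hne, Complex.exp_re]
    apply mul_nonneg (Real.exp_pos _).le
    have e : (Complex.log (1-z) * (1/2)).im = (1-z).arg / 2 := by
      have : (1/2:ℂ) = ((1/2:ℝ):ℂ) := by push_cast; rfl
      rw [this, Complex.im_mul_ofReal, Complex.log_im]; ring
    rw [e]
    apply Real.cos_nonneg_of_mem_Icc
    have h1 := Complex.neg_pi_lt_arg (1-z)
    have h2 := Complex.arg_le_pi (1-z)
    constructor <;> linarith
  have h1s : (1 + s) / 2 ∈ Complex.slitPlane := by
    left; simp; linarith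
  have h1s0 : 1 + s ≠ 0 := by
    intro h; rw [h] at h1s; simp at h1s
  have dS : HasDerivAt (fun z:ℂ => (1-z)^(1/2:ℂ)) (-1/(2*s)) z := by
    have := ((hasDerivAt_id' z).const_sub 1).cpow_const (c := (1/2:ℂ)) hsl
    convert this using 1
    rw [Complex.cpow_sub _ _ hne, ← hs, Complex.cpow_one, ← hs2]
    field_simp
  refine ⟨s, hs, hs2, hs0, h1s0, dS, ?_⟩
  have := ((dS.const_add 1).div_const 2).cpow_const (c := -2*a) (by rw [← hs]; exact h1s)
  convert this using 1
  rw [← hs, Complex.cpow_sub _ _ (Complex.slitPlane_ne_zero h1s), Complex.cpow_one]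
  field_simp

theorem gode (a : ℂ) : let g := (fun z : ℂ => ((1+(1-z)^(1/2:ℂ))/2)^(-2*a))
   ∀ z ∈ Metric.ball (0:ℂ) 1, z*(1-z)*deriv (deriv g) z + ((2*a+1)-(a+(a+1/2)+1)*z)*deriv g z - a*(a+1/2)*g z = 0 := by
  intro g z hz
  obtain ⟨s, hs, hs2, hs0, h1s0, dS, dg⟩ := gder a z hz
  have e : deriv g =ᶠ[nhds z] fun z => a * g z / ((1-z)^(1/2:ℂ) * (1+(1-z)^(1/2:ℂ))) := by
    filter_upwards [Metric.isOpen_ball.mem_nhds hz] with w hw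
    obtain ⟨s, hs, hs2, hs0, h1s0, dS, dg⟩ := gder a w hw
    rw [← hs]; exact dg.deriv
  have dg' : HasDerivAt g (a * g z / (s*(1+s))) z := dg
  have d2 := (dg'.const_mul a).div (dS.mul (dS.const_add 1)) (by rw [Pi.mul_apply, ← hs]; exact mul_ne_zero hs0 h1s0)
  have d3 := (d2.congr_of_eventuallyEq e).deriv
  rw [d3, dg'.deriv]
  simp only [Pi.mul_apply, ← hs]
  have hz' : z = 1 - s^2 := by rw [hs2]; ring
  generalize g z = G
  rw [hz']
  field_simp
  ring

theorem key (α x y : ℝ) (hα : 0 < α) (hx : 0 < x) (hxy : x < y) :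
  ∑' n : ℕ, ((ascPochhammer ℝ n).eval (α-1/2) * (ascPochhammer ℝ n).eval α /
    ((ascPochhammer ℝ n).eval (2*α) * (n.factorial : ℝ))) * (1 - x^2/y^2) ^ n = ((1 + x/y)/2)^(-(2*α-1)) := by
  have hy : 0 < y := hx.trans hxy
  have h1 : x^2/y^2 < 1 := by rw [div_lt_one (by positivity)]; gcongr
  have h2 : 0 < x^2/y^2 := by positivity
  refine gh (fun z : ℂ => ((1+(1-z)^(1/2:ℂ))/2)^(-2*((α-1/2:ℝ):ℂ))) _ _ _ (by positivity) ?_ ?_ ?_ _ (by linarith) (by linarith) _ ?_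
  · intro z hz
    obtain ⟨s, -, -, -, -, -, dg⟩ := gder ((α-1/2:ℝ):ℂ) z hz
    exact dg.differentiableAt.differentiableWithinAt
  · intro z hz
    have := gode ((α-1/2:ℝ):ℂ) z hz
    simp only at this
    push_cast at this ⊢
    linear_combination this
  · norm_num
  · have e1 : (1 - ((1 - x^2/y^2 : ℝ):ℂ)) = ((x^2/y^2 : ℝ):ℂ) := by push_cast; ring
    have e2 : ((x^2/y^2 : ℝ):ℂ)^(1/2:ℂ) = ((x/y:ℝ):ℂ) := by
      have : (1/2:ℂ) = ((1/2:ℝ):ℂ) := by push_cast; rfl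
      rw [this, ← Complex.ofReal_cpow h2.le, ← Real.sqrt_eq_rpow, ← div_pow, Real.sqrt_sq (by positivity)]
    simp only [e1, e2]
    rw [Complex.ofReal_cpow (by positivity)]
    push_cast
    ring_nf

theorem IB_nu_zero_eq_liouville (α : ℝ) (hα : 0 < α) (f : ℝ → ℝ)
    (hf : ContDiff ℝ (⊤ : ℕ∞) f) (hsupp : HasCompactSupport f)
    (hsupp' : tsupport f ⊆ Ioi (0 : ℝ)) (x : ℝ) (hx : 0 < x) :
    IB 0 α f x = (1 / Real.Gamma (2 * α)) * ∫ y in Ioi x, (y - x) ^ (2 * α - 1) * f y := by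
  unfold IB
  congr 1
  apply setIntegral_congr_fun measurableSet_Ioi
  intro y hy
  have hxy : x < y := hy
  have hy0 : 0 < y := hx.trans hxy
  have hk := key α x y hα hx hxy
  have e : α + (0 - 1) / 2 = α - 1 / 2 := by ring
  simp only [gaussHyp, e]
  rw [hk]
  congr 1
  have h2 : 0 < (1 + x / y) / 2 := by positivity
  have h3 : (y ^ 2 - x ^ 2) / (2 * y) = (y - x) * ((1 + x / y) / 2) := by
    field_simp; ring
  rw [h3, Real.mul_rpow (by linarith) h2.le, mul_assoc, ← Real.rpow_add h2]
  simp
end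

section
/- Let ν ≥ 0, α > 0, x > 0, and let m be a real number with m + 2α < 0 and m + 2α + ν < 1. Then the fractional Bessel integral of the power function y ↦ y^m is given by (IB_{ν,-}^α (y ↦ y^m))(x) = 2^{−2α} · [Γ(−α − m/2) · Γ((1 − ν)/2 − α − m/2)] / [Γ((1 − ν − m)/2) · Γ(−m/2)] · x^{2α + m}. -/
open MeasureTheory Set

lemma aux_beta (p q : ℝ) (hp : 0 < p) (hq : 0 < q) :
    ∫ t in Ioo (0:ℝ) 1, t ^ (p - 1) * (1 - t) ^ (q - 1) =
      Real.Gamma p * Real.Gamma q / Real.Gamma (p + q) := by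
  have h := ProbabilityTheory.beta_eq_betaIntegralReal p q hp hq
  rw [ProbabilityTheory.beta] at h
  rw [h, Complex.betaIntegral, intervalIntegral.integral_of_le (by norm_num),
      ← integral_Ioc_eq_integral_Ioo, ← RCLike.re_to_complex, ← integral_re]
  · refine setIntegral_congr_fun measurableSet_Ioc fun x ⟨hx1, hx₂⟩ ↦ ?_
    norm_cast
    rw [← Complex.ofReal_cpow, ← Complex.ofReal_cpow, RCLike.re_to_complex,
      Complex.re_mul_ofReal, Complex.ofReal_re]
    all_goals linarith
  · convert! Complex.betaIntegral_convergent (u := p) (v := q) (by simpa) (by simpa)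
    rw [intervalIntegrable_iff_integrableOn_Ioc_of_le (by simp), IntegrableOn]

lemma aux_beta_int (p q : ℝ) (hp : 0 < p) (hq : 0 < q) :
    Integrable (fun t : ℝ => t ^ (p - 1) * (1 - t) ^ (q - 1)) (volume.restrict (Ioo (0:ℝ) 1)) := by
  apply Integrable.of_integral_ne_zero
  rw [aux_beta p q hp hq]
  have := Real.Gamma_pos_of_pos hp
  have := Real.Gamma_pos_of_pos hq
  have := Real.Gamma_pos_of_pos (add_pos hp hq)
  positivity

lemma aux_gamma (p : ℝ) (hp : 0 < p) (n : ℕ) :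
    Real.Gamma (p + n) = (ascPochhammer ℝ n).eval p * Real.Gamma p := by
  induction n with
  | zero => simp
  | succ n ih =>
    rw [ascPochhammer_succ_eval, Nat.cast_succ, ← add_assoc, Real.Gamma_add_one (by positivity), ih]
    ring

lemma aux_swap (e : ℕ → ℝ) (p q : ℝ) (hp : 0 < p) (hq : 0 < q)
    (hs : Summable fun n => e n * ((ascPochhammer ℝ n).eval p / (ascPochhammer ℝ n).eval (p + q))) :
    ∫ t in Ioo (0:ℝ) 1, t ^ (p - 1) * (1 - t) ^ (q - 1) * ∑' n, e n * t ^ n =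
      Real.Gamma p * Real.Gamma q / Real.Gamma (p + q) *
        ∑' n, e n * ((ascPochhammer ℝ n).eval p / (ascPochhammer ℝ n).eval (p + q)) := by
  have key : ∀ n : ℕ, ∫ t in Ioo (0:ℝ) 1, t ^ (p + n - 1) * (1 - t) ^ (q - 1) =
      Real.Gamma p * Real.Gamma q / Real.Gamma (p + q) *
        ((ascPochhammer ℝ n).eval p / (ascPochhammer ℝ n).eval (p + q)) := by
    intro n
    rw [aux_beta (p + n) q (by positivity) hq, add_right_comm, aux_gamma p hp,
      aux_gamma (p + q) (by positivity)]
    have := Real.Gamma_pos_of_pos (add_pos hp hq)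
    have := ascPochhammer_pos n (p + q) (by positivity)
    field_simp
  have hpt : ∀ n : ℕ, ∀ t ∈ Ioo (0:ℝ) 1, t ^ (p - 1) * (1 - t) ^ (q - 1) * (e n * t ^ n) =
      e n * (t ^ (p + n - 1) * (1 - t) ^ (q - 1)) := by
    intro n t ht
    rw [show p + n - 1 = (p - 1) + n by ring, Real.rpow_add_natCast ht.1.ne']
    ring
  have hint : ∀ n : ℕ, ∫ t in Ioo (0:ℝ) 1, t ^ (p - 1) * (1 - t) ^ (q - 1) * (e n * t ^ n) =
      Real.Gamma p * Real.Gamma q / Real.Gamma (p + q) *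
        (e n * ((ascPochhammer ℝ n).eval p / (ascPochhammer ℝ n).eval (p + q))) := by
    intro n
    rw [setIntegral_congr_fun measurableSet_Ioo (hpt n), integral_const_mul, key]
    ring
  have hnorm : ∀ n : ℕ, ∫ t in Ioo (0:ℝ) 1, ‖t ^ (p - 1) * (1 - t) ^ (q - 1) * (e n * t ^ n)‖ =
      Real.Gamma p * Real.Gamma q / Real.Gamma (p + q) *
        ‖e n * ((ascPochhammer ℝ n).eval p / (ascPochhammer ℝ n).eval (p + q))‖ := by
    intro n
    have : ∀ t ∈ Ioo (0:ℝ) 1, ‖t ^ (p - 1) * (1 - t) ^ (q - 1) * (e n * t ^ n)‖ =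
      |e n| * (t ^ (p + n - 1) * (1 - t) ^ (q - 1)) := by
      intro t ht
      have h1 : 0 ≤ t ^ (p + n - 1) := Real.rpow_nonneg ht.1.le _
      have h2 : 0 ≤ (1 - t) ^ (q - 1) := Real.rpow_nonneg (by linarith [ht.2]) _
      rw [hpt n t ht, Real.norm_eq_abs, abs_mul, abs_of_nonneg (mul_nonneg h1 h2)]
    rw [setIntegral_congr_fun measurableSet_Ioo this, integral_const_mul, key]
    have h1 := ascPochhammer_pos n (p + q) (by positivity)
    have h2 := ascPochhammer_pos n p hp
    rw [Real.norm_eq_abs, abs_mul, abs_of_pos (div_pos h2 h1)]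
    ring
  have H := hasSum_integral_of_summable_integral_norm (μ := volume.restrict (Ioo (0:ℝ) 1))
    (F := fun (n : ℕ) (t : ℝ) => t ^ (p - 1) * (1 - t) ^ (q - 1) * (e n * t ^ n)) ?_ ?_
  · simp only [tsum_mul_left] at H
    rw [← H.tsum_eq, tsum_congr hint, tsum_mul_left]
  · intro n
    have h := (aux_beta_int (p + n) q (by positivity) hq).const_mul (e n)
    exact (integrableOn_congr_fun (fun t ht => (hpt n t ht)) measurableSet_Ioo).2 h
  · simp only [hnorm]
    exact (hs.norm).mul_left _

lemma aux_summable (a b d : ℝ) (ha : -1 < a) (hb : 0 < b) (hd : 0 < d) (h : 0 < d - a - b) :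
    Summable fun n : ℕ => (ascPochhammer ℝ n).eval a / (n.factorial : ℝ) *
      ((ascPochhammer ℝ n).eval b / (ascPochhammer ℝ n).eval d) := by
  set u : ℕ → ℝ := fun n : ℕ => (ascPochhammer ℝ n).eval a / (n.factorial : ℝ) *
      ((ascPochhammer ℝ n).eval b / (ascPochhammer ℝ n).eval d) with hu
  have hrec : ∀ n : ℕ, 1 ≤ n → (n + d) * |u (n + 1)| = |u n| * ((n + a) * (n + b) / (n + 1)) := by
    intro n hn
    have hn' : (1:ℝ) ≤ n := by exact_mod_cast hn
    have h1 := ascPochhammer_pos n d hd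
    have h2 : (0:ℝ) < n.factorial := by positivity
    have hna : 0 < n + a := by linarith
    have e1 : (n + d) * u (n + 1) = u n * ((n + a) * (n + b) / (n + 1)) := by
      simp only [hu, ascPochhammer_succ_eval, Nat.factorial_succ]
      push_cast
      have : d + n ≠ 0 := by positivity
      field_simp
      ring
    have e2 := congrArg abs e1
    rwa [abs_mul (n + d), abs_mul (u n), abs_of_pos (a := (n:ℝ) + d) (by positivity),
      abs_of_pos (a := (n + a) * (n + b) / ((n:ℝ) + 1)) (by positivity)] at e2
  set δ := (d - a - b) / 2 with hδ
  have hδ0 : 0 < δ := by positivity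
  obtain ⟨N, hN⟩ := exists_nat_ge (max 1 ((δ + 1 + a * b - d) / δ))
  have hN1 : (1:ℝ) ≤ N := (le_max_left _ _).trans hN
  have hN2 : δ + 1 + a * b - d ≤ N * δ := by
    have := (le_max_right _ _).trans hN
    rwa [div_le_iff₀ hδ0] at this
  have hstep : ∀ n : ℕ, N ≤ n → δ * |u n| ≤ (n + d - 1) * |u n| - (n + d) * |u (n + 1)| := by
    intro n hn
    have hn' : (N:ℝ) ≤ n := by exact_mod_cast hn
    rw [hrec n (by exact_mod_cast hN1.trans hn')]
    have : δ ≤ (n + d - 1) - (n + a) * (n + b) / (n + 1) := by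
      rw [le_sub_iff_add_le, ← le_sub_iff_add_le', div_le_iff₀ (by positivity)]
      have : N * δ ≤ n * δ := by gcongr
      have e : d = 2 * δ + a + b := by rw [hδ]; ring
      nlinarith
    nlinarith [abs_nonneg (u n)]
  rw [← summable_abs_iff, ← summable_nat_add_iff N]
  refine summable_of_sum_range_le (c := (N + d - 1) * |u N| / δ) (fun _ => abs_nonneg _) ?_
  intro K
  rw [le_div_iff₀ hδ0]
  have : ∀ K : ℕ, (∑ i ∈ Finset.range K, |u (i + N)|) * δ ≤
      (N + d - 1) * |u N| - ((K + N : ℕ) + d - 1) * |u (K + N)| := by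
    intro K
    induction K with
    | zero => simp
    | succ K ih =>
      rw [Finset.sum_range_succ, add_mul]
      have := hstep (K + N) (by omega)
      rw [show K + 1 + N = K + N + 1 by ring]
      push_cast at *
      linarith
  refine (this K).trans ?_
  have : 0 ≤ ((K + N : ℕ) + d - 1) * |u (K + N)| := by
    apply mul_nonneg _ (abs_nonneg _)
    push_cast
    have : (0:ℝ) ≤ K := by positivity
    linarith
  linarith

lemma aux_binom (a t : ℝ) (ht : t ∈ Ioo (0:ℝ) 1) :
    ∑' n : ℕ, (ascPochhammer ℝ n).eval a / (n.factorial : ℝ) * t ^ n = (1 - t) ^ (-a) := by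
  have h := (Real.one_div_one_sub_rpow_hasFPowerSeriesOnBall_zero a).hasSum (y := t)
    (by simp [enorm_eq_nnnorm, ← NNReal.coe_lt_one, abs_of_pos ht.1, ht.2])
  rw [zero_add] at h
  rw [Real.rpow_neg (by linarith [ht.2]), ← one_div, ← h.tsum_eq]
  refine tsum_congr fun n => ?_
  simp only [FormalMultilinearSeries.ofScalars_apply_eq, smul_eq_mul]
  congr 1
  rw [Ring.choose, ← Polynomial.ascPochhammer_smeval_eq_eval,
    show a + n - 1 - n + 1 = a by ring, ← Ring.factorial_nsmul_multichoose_eq_ascPochhammer]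
  have : (0:ℝ) < n.factorial := by positivity
  rw [nsmul_eq_mul]
  field_simp

lemma aux_gauss (a b d : ℝ) (ha : -1 < a) (hb : 0 < b) (hdb : b < d) (h : 0 < d - a - b) :
    Real.Gamma (d - a) * Real.Gamma (d - b) *
    ∑' n : ℕ, (ascPochhammer ℝ n).eval a / (n.factorial : ℝ) *
      ((ascPochhammer ℝ n).eval b / (ascPochhammer ℝ n).eval d) =
    Real.Gamma d * Real.Gamma (d - a - b) := by
  have hs := aux_summable a b d ha hb (hb.trans hdb) h
  have H := aux_swap (fun n => (ascPochhammer ℝ n).eval a / (n.factorial : ℝ)) b (d - b) hb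
    (by linarith) (by simpa using hs)
  have H2 : ∫ t in Ioo (0:ℝ) 1, t ^ (b - 1) * (1 - t) ^ (d - b - 1) *
      ∑' n : ℕ, (ascPochhammer ℝ n).eval a / (n.factorial : ℝ) * t ^ n =
      ∫ t in Ioo (0:ℝ) 1, t ^ (b - 1) * (1 - t) ^ (d - a - b - 1) := by
    refine setIntegral_congr_fun measurableSet_Ioo fun t ht => ?_
    rw [aux_binom a t ht, mul_assoc, ← Real.rpow_add (by linarith [ht.2])]
    congr 2
    ring
  rw [H2, aux_beta b _ hb h] at H
  rw [show b + (d - b) = d by ring, show b + (d - a - b) = d - a by ring] at H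
  have g1 := Real.Gamma_pos_of_pos hb
  have g2 := Real.Gamma_pos_of_pos (hb.trans hdb)
  have g3 := Real.Gamma_pos_of_pos (show 0 < d - a by linarith)
  generalize (∑' n : ℕ, (ascPochhammer ℝ n).eval a / (n.factorial : ℝ) *
      ((ascPochhammer ℝ n).eval b / (ascPochhammer ℝ n).eval d)) = S at *
  field_simp at H
  linarith

theorem IB_power_function (ν α x m : ℝ) (hν : 0 ≤ ν) (hα : 0 < α) (hx : 0 < x)
    (hm : m + 2 * α < 0) (hm' : m + 2 * α + ν < 1) :
    IB ν α (fun y => y ^ m) x =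
      (2 : ℝ) ^ (-(2 * α)) *
        (Real.Gamma (-α - m / 2) * Real.Gamma ((1 - ν) / 2 - α - m / 2)) /
        (Real.Gamma ((1 - ν - m) / 2) * Real.Gamma (-m / 2)) *
        x ^ (2 * α + m) := by
  set a := α + (ν - 1) / 2 with ha
  have hs0 : 0 < -α - m / 2 := by linarith
  have hd0 : 0 < 2 * α + (-α - m / 2) := by linarith
  have hterm : ∀ n : ℕ, ((ascPochhammer ℝ n).eval a * (ascPochhammer ℝ n).eval α /
      ((ascPochhammer ℝ n).eval (2 * α) * (n.factorial : ℝ))) *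
      ((ascPochhammer ℝ n).eval (2 * α) / (ascPochhammer ℝ n).eval (2 * α + (-α - m / 2))) =
      (ascPochhammer ℝ n).eval a / (n.factorial : ℝ) *
      ((ascPochhammer ℝ n).eval α / (ascPochhammer ℝ n).eval (2 * α + (-α - m / 2))) := by
    intro n
    have h1 := ascPochhammer_pos n (2 * α) (by positivity)
    have h2 := ascPochhammer_pos n _ hd0
    have : (0:ℝ) < n.factorial := by positivity
    field_simp
  have ha1 : -1 < a := by linarith
  have hc1 : 0 < 2 * α + (-α - m / 2) - a - α := by linarith
  have hsum := aux_summable a α _ ha1 hα hd0 hc1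
  have hgauss := aux_gauss a α (2 * α + (-α - m / 2)) ha1 hα (by linarith) hc1
  have hswap := aux_swap _ (2 * α) (-α - m / 2) (by positivity) hs0
    (hsum.congr fun n => (hterm n).symm)
  rw [tsum_congr hterm] at hswap
  have himg : (fun y : ℝ => 1 - x ^ 2 / y ^ 2) '' Ioi x = Ioo 0 1 := by
    ext t
    constructor
    · rintro ⟨y, hy, rfl⟩
      have hy : x < y := hy
      have hy0 : 0 < y := hx.trans hy
      have : x ^ 2 / y ^ 2 < 1 := by
        rw [div_lt_one (by positivity)]; gcongr
      have : 0 < x ^ 2 / y ^ 2 := by positivity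
      constructor <;> simp only <;> linarith
    · rintro ⟨h0, h1⟩
      have hp : 0 < 1 - t := by linarith
      have hq : 0 < √(1 - t) := Real.sqrt_pos.2 hp
      refine ⟨x / √(1 - t), ?_, ?_⟩
      · rw [mem_Ioi, lt_div_iff₀ hq]
        have : √(1 - t) < 1 := by
          rw [Real.sqrt_lt' one_pos]; linarith
        nlinarith
      · change 1 - x ^ 2 / (x / √(1 - t)) ^ 2 = t
        rw [div_pow, Real.sq_sqrt hp.le]
        field_simp
        ring
  have hder : ∀ y ∈ Ioi x, HasDerivWithinAt (fun y : ℝ => 1 - x ^ 2 / y ^ 2)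
      (2 * x ^ 2 / y ^ 3) (Ioi x) y := by
    intro y hy
    have hy0 : 0 < y := hx.trans hy
    have := ((hasDerivAt_const y (x ^ 2)).div (hasDerivAt_pow 2 y) (by positivity)).const_sub 1
    have e : -((0 * y ^ 2 - x ^ 2 * (((2:ℕ):ℝ) * y ^ (2 - 1))) / (y ^ 2) ^ 2) =
        2 * x ^ 2 / y ^ 3 := by
      push_cast
      simp only [Nat.add_one_sub_one, pow_one]
      field_simp
      ring
    rw [e] at this
    exact this.hasDerivWithinAt
  have hinj : InjOn (fun y : ℝ => 1 - x ^ 2 / y ^ 2) (Ioi x) := by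
    intro y hy z hz h
    have hy0 : 0 < y := hx.trans hy
    have hz0 : 0 < z := hx.trans hz
    have h' : x ^ 2 / y ^ 2 = x ^ 2 / z ^ 2 := by
      have h : 1 - x ^ 2 / y ^ 2 = 1 - x ^ 2 / z ^ 2 := h
      linarith
    field_simp at h'
    exact ((pow_left_inj₀ hz0.le hy0.le two_ne_zero).1 h').symm
  have hcv := integral_image_eq_integral_abs_deriv_smul measurableSet_Ioi hder hinj
    (fun t => t ^ (2 * α - 1) * (1 - t) ^ (-α - m / 2 - 1) * gaussHyp a α (2 * α) t)
  rw [himg] at hcv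
  have hswap' : ∫ t in Ioo (0:ℝ) 1, t ^ (2 * α - 1) * (1 - t) ^ (-α - m / 2 - 1) *
      gaussHyp a α (2 * α) t = _ := hswap
  rw [hswap'] at hcv
  have hI : ∫ y in Ioi x, ((y ^ 2 - x ^ 2) / (2 * y)) ^ (2 * α - 1) *
      gaussHyp a α (2 * α) (1 - x ^ 2 / y ^ 2) * y ^ m =
      (2 ^ (-(2 * α)) * x ^ (2 * α + m)) *
      (Real.Gamma (2 * α) * Real.Gamma (-α - m / 2) / Real.Gamma (2 * α + (-α - m / 2)) *
        ∑' n : ℕ, (ascPochhammer ℝ n).eval a / (n.factorial : ℝ) *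
      ((ascPochhammer ℝ n).eval α / (ascPochhammer ℝ n).eval (2 * α + (-α - m / 2)))) := by
    rw [hcv, ← integral_const_mul]
    refine setIntegral_congr_fun measurableSet_Ioi fun y hy => ?_
    have hy0 : 0 < y := hx.trans hy
    have hxy : x < y := hy
    have ht : 0 < 1 - x ^ 2 / y ^ 2 := by
      rw [sub_pos, div_lt_one (by positivity)]; gcongr
    simp only [smul_eq_mul]
    rw [show (y ^ 2 - x ^ 2) / (2 * y) = (1 - x ^ 2 / y ^ 2) * (y / 2) by field_simp,
      Real.mul_rpow ht.le (by positivity), sub_sub_cancel, abs_of_pos (by positivity)]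
    have e : (y / 2) ^ (2 * α - 1) * y ^ m = 2 ^ (-(2 * α)) * x ^ (2 * α + m) *
        (2 * x ^ 2 / y ^ 3 * (x ^ 2 / y ^ 2) ^ (-α - m / 2 - 1)) := by
      rw [Real.div_rpow hy0.le (by norm_num), Real.div_rpow (by positivity) (by positivity),
        ← Real.rpow_natCast x 2, ← Real.rpow_natCast y 2, ← Real.rpow_natCast y 3,
        ← Real.rpow_mul hx.le, ← Real.rpow_mul hy0.le]
      have l1 : y ^ (2 * α - 1) / 2 ^ (2 * α - 1) * y ^ m =
          2 ^ (1 - 2 * α) * y ^ (2 * α - 1 + m) := by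
        rw [Real.rpow_add hy0, show 1 - 2 * α = -(2 * α - 1) by ring,
          Real.rpow_neg (by norm_num : (0:ℝ) ≤ 2)]
        ring
      rw [l1]
      have l2 : (2:ℝ) ^ (1 - 2 * α) = 2 * 2 ^ (-(2 * α)) := by
        rw [sub_eq_add_neg, Real.rpow_add (by norm_num), Real.rpow_one]
      have l3 : x ^ (2 * α + m) * x ^ ((2:ℕ):ℝ) * x ^ (((2:ℕ):ℝ) * (-α - m / 2 - 1)) = 1 := by
        rw [← Real.rpow_add hx, ← Real.rpow_add hx]
        convert Real.rpow_zero x using 2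
        push_cast
        ring
      have l4 : y ^ (2 * α - 1 + m) * y ^ ((3:ℕ):ℝ) * y ^ (((2:ℕ):ℝ) * (-α - m / 2 - 1)) = 1 := by
        rw [← Real.rpow_add hy0, ← Real.rpow_add hy0]
        convert Real.rpow_zero y using 2
        push_cast
        ring
      rw [l2]
      have p1 := Real.rpow_pos_of_pos hy0 ((3:ℕ):ℝ)
      have p2 := Real.rpow_pos_of_pos hy0 (((2:ℕ):ℝ) * (-α - m / 2 - 1))
      generalize y ^ ((3:ℕ):ℝ) = Y3 at *
      generalize y ^ (((2:ℕ):ℝ) * (-α - m / 2 - 1)) = Y2 at *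
      generalize x ^ (((2:ℕ):ℝ) * (-α - m / 2 - 1)) = X2 at *
      generalize x ^ (2 * α + m) = X1 at *
      generalize x ^ ((2:ℕ):ℝ) = X3 at *
      generalize y ^ (2 * α - 1 + m) = Y1 at *
      generalize (2:ℝ) ^ (-(2 * α)) = T at *
      field_simp
      linear_combination T * (l4 - l3)
    linear_combination ((1 - x ^ 2 / y ^ 2) ^ (2 * α - 1) *
      gaussHyp a α (2 * α) (1 - x ^ 2 / y ^ 2)) * e
  rw [IB, ← ha, hI]
  rw [show 2 * α + (-α - m / 2) - a = (1 - ν - m) / 2 by rw [ha]; ring,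
    show 2 * α + (-α - m / 2) - α = -m / 2 by ring,
    show (1 - ν - m) / 2 - α = (1 - ν) / 2 - α - m / 2 by ring] at hgauss
  have g1 := Real.Gamma_pos_of_pos hd0
  have g2 := Real.Gamma_pos_of_pos (show 0 < 2 * α by positivity)
  have g3 := Real.Gamma_pos_of_pos (show 0 < (1 - ν - m) / 2 by linarith)
  have g4 := Real.Gamma_pos_of_pos (show 0 < -m / 2 by linarith)
  generalize (∑' n : ℕ, (ascPochhammer ℝ n).eval a / (n.factorial : ℝ) *
      ((ascPochhammer ℝ n).eval α / (ascPochhammer ℝ n).eval (2 * α + (-α - m / 2)))) = S at *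
  generalize Real.Gamma (2 * α + (-α - m / 2)) = G1 at *
  generalize Real.Gamma (2 * α) = G2 at *
  generalize Real.Gamma ((1 - ν - m) / 2) = G3 at *
  generalize Real.Gamma (-m / 2) = G4 at *
  generalize Real.Gamma ((1 - ν) / 2 - α - m / 2) = G5 at *
  generalize Real.Gamma (-α - m / 2) = G6 at *
  generalize (2:ℝ) ^ (-(2 * α)) = T at *
  generalize x ^ (2 * α + m) = X at *
  clear hI hcv hswap hswap'
  field_simp
  linear_combination T * X * G6 * hgauss
end

section
/- Let ν ≥ 0, α > 0, let f : (0,∞) → ℝ be smooth with compact support contained in (0,∞), and let s be a real number with s > 0 and s > ν − 1. Then the Mellin transform of the fractional Bessel integral satisfies (IB_{ν,-}^α f)*(s) = 2^{−2α} · [Γ(s/2) · Γ((s − ν + 1)/2)] / [Γ(α + (s − ν + 1)/2) · Γ(α + s/2)] · f*(2α + s). -/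
open MeasureTheory Set

/-- Mellin transform of a function on the semiaxis. -/
noncomputable def mellinT (f : ℝ → ℝ) (s : ℝ) : ℝ :=
  ∫ x in Ioi (0 : ℝ), x ^ (s - 1) * f x

open Filter Topology

noncomputable abbrev PP (n : ℕ) (a : ℝ) : ℝ := (ascPochhammer ℝ n).eval a

noncomputable abbrev gco (a b c : ℝ) (n : ℕ) : ℝ :=
  PP n a * PP n b / (PP n c * (n.factorial : ℝ))

lemma PP_pos {c : ℝ} (hc : 0 < c) (n : ℕ) : 0 < PP n c := ascPochhammer_pos n c hc

lemma gco_succ (a b : ℝ) {c : ℝ} (hc : 0 < c) (n : ℕ) :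
    gco a b c (n+1) * ((c + n) * (n + 1)) = gco a b c n * ((a + n) * (b + n)) := by
  have h1 := (PP_pos hc n).ne'
  have h2 : (n.factorial : ℝ) ≠ 0 := by positivity
  have h3 : c + n ≠ 0 := by positivity
  have h4 : (n : ℝ) + 1 ≠ 0 := by positivity
  simp only [gco, PP, ascPochhammer_succ_eval, Nat.factorial_succ] at *
  push_cast
  field_simp

lemma summable_tele {u v : ℕ → ℝ} {δ : ℝ} (hδ : 0 < δ) (hu : ∀ n, 0 ≤ u n) (hv : ∀ n, 0 ≤ v n)
    (h : ∀ᶠ n in atTop, δ * u n ≤ v n - v (n + 1)) : Summable u := by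
  obtain ⟨N, hN⟩ := eventually_atTop.1 h
  rw [← summable_nat_add_iff N]
  refine summable_of_sum_range_le (c := v N / δ) (fun n => hu _) (fun n => ?_)
  rw [le_div_iff₀ hδ, Finset.sum_mul]
  calc ∑ i ∈ Finset.range n, u (i + N) * δ
      ≤ ∑ i ∈ Finset.range n, (v (i + N) - v (i + 1 + N)) := by
        refine Finset.sum_le_sum fun i _ => ?_
        have := hN (i + N) (by omega)
        rw [show i + 1 + N = i + N + 1 by ring]
        linarith
    _ = v (0 + N) - v (n + N) := Finset.sum_range_sub' (fun i => v (i + N)) n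
    _ ≤ v N := by simpa using hv (n + N)

lemma summable_gco {a b c : ℝ} (hc : 0 < c) (h : 0 < c - a - b) :
    Summable fun n => |gco a b c n| := by
  refine summable_tele (v := fun n => n * |gco a b c n|) (half_pos h) (fun n => abs_nonneg _)
    (fun n => by positivity) ?_
  have ht : Tendsto (fun n : ℕ => (n : ℝ)) atTop atTop := tendsto_natCast_atTop_atTop
  filter_upwards [ht.eventually_ge_atTop (-a), ht.eventually_ge_atTop (-b),
    ht.eventually_ge_atTop ((a * b + (c - a - b) / 2 * c) / ((c - a - b) / 2))] with n h1 h2 h3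
  rw [div_le_iff₀ (half_pos h)] at h3
  have e := congrArg abs (gco_succ a b hc n)
  have hcn : 0 < c + n := by positivity
  rw [abs_mul, abs_mul (gco a b c n), abs_of_nonneg (a := (c + n) * ((n : ℝ) + 1)) (by positivity),
    abs_of_nonneg (a := (a + n) * (b + n)) (mul_nonneg (by linarith) (by linarith))] at e
  set U := |gco a b c n|
  set V := |gco a b c (n + 1)|
  have hU : 0 ≤ U := abs_nonneg _
  have : V * (n + 1) = U * ((a + n) * (b + n)) / (c + n) := by
    rw [eq_div_iff hcn.ne', ← e]; ring
  push_cast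
  rw [mul_comm _ V, this, le_sub_iff_add_le, ← le_sub_iff_add_le', div_le_iff₀ hcn]
  nlinarith [mul_nonneg hU (sub_nonneg.2 h3)]

lemma summable_hyp (a b : ℝ) {c z : ℝ} (hc : 0 < c) (hz : |z| < 1) :
    Summable fun n => gco a b c n * z ^ n := by
  obtain ⟨r, hr1, hr2⟩ := exists_between hz
  refine summable_of_ratio_norm_eventually_le hr2 ?_
  have t1 : Tendsto (fun n : ℕ => (a + 1 * (n : ℝ)) / (c + 1 * n)) atTop (𝓝 (1 / 1)) :=
    (tendsto_add_mul_div_add_mul_atTop_nhds a c 1 one_ne_zero)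
  have t2 : Tendsto (fun n : ℕ => (b + 1 * (n : ℝ)) / (1 + 1 * n)) atTop (𝓝 (1 / 1)) :=
    (tendsto_add_mul_div_add_mul_atTop_nhds b 1 1 one_ne_zero)
  have t3 := ((t1.mul t2).abs.mul_const |z|)
  have : |(1:ℝ) / 1 * (1 / 1)| * |z| < r := by simpa using hr1
  filter_upwards [t3.eventually_lt_const this] with n hn
  have hcn : 0 < c + n := by positivity
  have e : gco a b c (n+1) = gco a b c n * ((a + 1 * n) / (c + 1 * n) * ((b + 1 * n) / (1 + 1 * n))) := by
    have h4 : (n : ℝ) + 1 ≠ 0 := by positivity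
    have := gco_succ a b hc n
    rw [← eq_div_iff (by positivity)] at this
    rw [this]
    have := hcn.ne'
    simp only [one_mul]
    rw [add_comm 1 (n : ℝ)]
    field_simp
  rw [e, pow_succ, Real.norm_eq_abs, Real.norm_eq_abs]
  set q := ((a + 1 * n) / (c + 1 * n) * ((b + 1 * n) / (1 + 1 * n)))
  calc |gco a b c n * q * (z ^ n * z)| = (|q| * |z|) * |gco a b c n * z ^ n| := by
        simp only [abs_mul]; ring
    _ ≤ _ := by gcongr

lemma measurable_hyp (a b : ℝ) {c : ℝ} (hc : 0 < c) :
    Measurable ((Ioo (0:ℝ) 1).indicator (gaussHyp a b c)) := by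
  refine measurable_of_tendsto_metrizable (f := fun (N : ℕ) => (Ioo (0:ℝ) 1).indicator
    (fun z => ∑ n ∈ Finset.range N, gco a b c n * z ^ n)) (fun N => ?_) ?_
  · exact Measurable.indicator (by fun_prop) measurableSet_Ioo
  · rw [tendsto_pi_nhds]
    intro z
    by_cases hz : z ∈ Ioo (0:ℝ) 1
    · simp only [indicator_of_mem hz]
      exact (summable_hyp a b hc (by rw [abs_of_pos hz.1]; exact hz.2)).hasSum.tendsto_sum_nat
    · simp [indicator_of_notMem hz]

lemma Gamma_PP {c : ℝ} (hc : 0 < c) (n : ℕ) : Real.Gamma (c + n) = PP n c * Real.Gamma c := by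
  induction n with
  | zero => simp [PP]
  | succ n ih =>
    push_cast
    rw [← add_assoc, Real.Gamma_add_one (by positivity), ih, PP, PP, ascPochhammer_succ_eval]
    ring

lemma beta_int {u v : ℝ} (hu : 0 < u) (hv : 0 < v) :
    ∫ t in Ioo (0:ℝ) 1, t ^ (u - 1) * (1 - t) ^ (v - 1) =
      Real.Gamma u * Real.Gamma v / Real.Gamma (u + v) := by
  have h := Complex.betaIntegral_eq_Gamma_mul_div u v (by simpa) (by simpa)
  rw [Complex.betaIntegral, intervalIntegral.integral_of_le zero_le_one,
    integral_Ioc_eq_integral_Ioo] at h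
  have h2 : ∫ x in Ioo (0:ℝ) 1, (x : ℂ) ^ ((u : ℂ) - 1) * (1 - (x : ℂ)) ^ ((v : ℂ) - 1) =
      ∫ x in Ioo (0:ℝ) 1, ((x ^ (u - 1) * (1 - x) ^ (v - 1) : ℝ) : ℂ) := by
    refine setIntegral_congr_fun measurableSet_Ioo fun x hx => ?_
    push_cast
    rw [Complex.ofReal_cpow hx.1.le, Complex.ofReal_cpow (by linarith [hx.2])]
    push_cast
    rfl
  rw [h2, integral_complex_ofReal, ← Complex.ofReal_add] at h
  simp only [Complex.Gamma_ofReal] at h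
  exact_mod_cast h

lemma beta_integrable {u v : ℝ} (hu : 0 < u) (hv : 0 < v) :
    IntegrableOn (fun t : ℝ => t ^ (u - 1) * (1 - t) ^ (v - 1)) (Ioo (0:ℝ) 1) := by
  refine Integrable.of_integral_ne_zero ?_
  rw [beta_int hu hv]
  have := Real.Gamma_pos_of_pos hu
  have := Real.Gamma_pos_of_pos hv
  have := Real.Gamma_pos_of_pos (add_pos hu hv)
  positivity

lemma binom_hasSum (a : ℝ) {t : ℝ} (ht : t ∈ Ioo (0:ℝ) 1) :
    HasSum (fun n : ℕ => PP n a / n.factorial * t ^ n) ((1 - t) ^ (-a)) := by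
  have h := (Real.one_div_one_sub_rpow_hasFPowerSeriesOnBall_zero a).hasSum (y := t) (by
    simp [enorm_eq_nnnorm]
    rw [← NNReal.coe_lt_coe]; simpa [abs_of_pos ht.1] using ht.2)
  rw [Real.rpow_neg (by linarith [ht.2]), ← one_div]
  simp only [zero_add] at h
  refine (funext fun n => ?_ : (fun n : ℕ => PP n a / n.factorial * t ^ n) = _) ▸ h
  simp [FormalMultilinearSeries.ofScalars, Ring.choose_eq_smul, Polynomial.descPochhammer_smeval_eq_ascPochhammer,
    Polynomial.ascPochhammer_smeval_cast, Polynomial.ascPochhammer_smeval_eq_eval]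
  left
  ring_nf

lemma gauss_sum {a b c : ℝ} (hc : 0 < c) (hb : 0 < b) (hcb : 0 < c - b) (h : 0 < c - a - b) :
    ∑' n, gco a b c n = Real.Gamma c * Real.Gamma (c - a - b) /
      (Real.Gamma (c - a) * Real.Gamma (c - b)) := by
  set F : ℕ → ℝ → ℝ := fun n t => PP n a / n.factorial * (t ^ (b + n - 1) * (1 - t) ^ (c - b - 1))
  have hbn : ∀ n : ℕ, 0 < b + n := fun n => by positivity
  have hG1 := Real.Gamma_pos_of_pos hb
  have hG2 := Real.Gamma_pos_of_pos hcb
  have hG3 := Real.Gamma_pos_of_pos hc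
  have hG4 := Real.Gamma_pos_of_pos (show 0 < c - a by linarith)
  set K := Real.Gamma b * Real.Gamma (c - b) / Real.Gamma c with hK
  have hKpos : 0 < K := by positivity
  have key : ∀ n : ℕ, (∫ t in Ioo (0:ℝ) 1, t ^ (b + n - 1) * (1 - t) ^ (c - b - 1)) =
      PP n b / PP n c * K := by
    intro n
    rw [beta_int (hbn n) hcb, show b + n + (c - b) = c + n by ring, Gamma_PP hb, Gamma_PP hc]
    have := (PP_pos hc n).ne'
    rw [hK]; field_simp
  have hFi : ∀ n, Integrable (F n) (volume.restrict (Ioo (0:ℝ) 1)) := fun n =>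
    (beta_integrable (hbn n) hcb).const_mul _
  have hI : ∀ n, ∫ t in Ioo (0:ℝ) 1, F n t = gco a b c n * K := by
    intro n
    simp only [F]
    rw [integral_const_mul, key, gco]
    have := (PP_pos hc n).ne'
    field_simp
  have hN : ∀ n, ∫ t in Ioo (0:ℝ) 1, ‖F n t‖ = |gco a b c n| * K := by
    intro n
    have : ∫ t in Ioo (0:ℝ) 1, ‖F n t‖ =
        ∫ t in Ioo (0:ℝ) 1, |PP n a / n.factorial| * (t ^ (b + n - 1) * (1 - t) ^ (c - b - 1)) := by
      refine setIntegral_congr_fun measurableSet_Ioo fun t ht => ?_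
      have h1 := ht.1
      have h2 : 0 < 1 - t := by linarith [ht.2]
      simp only [F, Real.norm_eq_abs, abs_mul]
      rw [abs_of_pos (Real.rpow_pos_of_pos h1 _), abs_of_pos (Real.rpow_pos_of_pos h2 _)]
    rw [this, integral_const_mul, key, gco, abs_div, abs_div, abs_mul, abs_mul,
      abs_of_pos (PP_pos hc n), abs_of_pos (PP_pos hb n)]
    have := (PP_pos hc n).ne'
    have h2 : |(n.factorial : ℝ)| ≠ 0 := by positivity
    field_simp
  have hs := hasSum_integral_of_summable_integral_norm hFi (by
    simp only [hN]; exact (summable_gco hc h).mul_right K)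
  have hT : ∫ t in Ioo (0:ℝ) 1, ∑' n, F n t =
      ∫ t in Ioo (0:ℝ) 1, t ^ (b - 1) * (1 - t) ^ (c - a - b - 1) := by
    refine setIntegral_congr_fun measurableSet_Ioo fun t ht => ?_
    have h1 := ht.1
    have h2 : 0 < 1 - t := by linarith [ht.2]
    have := (binom_hasSum a ht).mul_left (t ^ (b - 1) * (1 - t) ^ (c - b - 1))
    rw [show c - a - b - 1 = (c - b - 1) + (-a) by ring, Real.rpow_add h2, ← mul_assoc,
      ← this.tsum_eq]
    refine tsum_congr fun n => ?_
    simp only [F]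
    rw [show b + n - 1 = (b - 1) + n by ring, Real.rpow_add h1, Real.rpow_natCast]
    ring
  rw [hT, beta_int hb h, show b + (c - a - b) = c - a by ring] at hs
  simp only [hI] at hs
  have := hs.tsum_eq
  rw [tsum_mul_right, ← eq_div_iff hKpos.ne'] at this
  rw [this, hK]
  field_simp

lemma J_int {a b c ρ : ℝ} (hc : 0 < c) (hρ : 0 < ρ) (hb : 0 < b) (hcb : 0 < c + ρ - b)
    (h : 0 < c + ρ - a - b) :
    ∫ t in Ioo (0:ℝ) 1, t ^ (ρ - 1) * (1 - t) ^ (c - 1) * gaussHyp a b c (1 - t) =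
      Real.Gamma c * Real.Gamma ρ * Real.Gamma (c + ρ - a - b) /
      (Real.Gamma (c + ρ - a) * Real.Gamma (c + ρ - b)) := by
  set F : ℕ → ℝ → ℝ := fun n t => gco a b c n * (t ^ (ρ - 1) * (1 - t) ^ (c + n - 1))
  have hcn : ∀ n : ℕ, 0 < c + n := fun n => by positivity
  have hcρ : 0 < c + ρ := by positivity
  have hG1 := Real.Gamma_pos_of_pos hc
  have hG2 := Real.Gamma_pos_of_pos hρ
  have hG3 := Real.Gamma_pos_of_pos hcρ
  set K := Real.Gamma c * Real.Gamma ρ / Real.Gamma (c + ρ) with hK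
  have key : ∀ n : ℕ, (∫ t in Ioo (0:ℝ) 1, t ^ (ρ - 1) * (1 - t) ^ (c + n - 1)) =
      PP n c / PP n (c + ρ) * K := by
    intro n
    rw [beta_int hρ (hcn n), show ρ + (c + n) = c + ρ + n by ring, Gamma_PP hc, Gamma_PP hcρ]
    have := (PP_pos hcρ n).ne'
    rw [hK]; field_simp
  have hFi : ∀ n, Integrable (F n) (volume.restrict (Ioo (0:ℝ) 1)) := fun n =>
    (beta_integrable hρ (hcn n)).const_mul _
  have hI : ∀ n, ∫ t in Ioo (0:ℝ) 1, F n t = gco a b (c + ρ) n * K := by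
    intro n
    simp only [F]
    rw [integral_const_mul, key, gco, gco]
    have := (PP_pos hc n).ne'
    have := (PP_pos hcρ n).ne'
    field_simp
  have hN : ∀ n, ∫ t in Ioo (0:ℝ) 1, ‖F n t‖ = |gco a b (c + ρ) n| * K := by
    intro n
    have : ∫ t in Ioo (0:ℝ) 1, ‖F n t‖ =
        ∫ t in Ioo (0:ℝ) 1, |gco a b c n| * (t ^ (ρ - 1) * (1 - t) ^ (c + n - 1)) := by
      refine setIntegral_congr_fun measurableSet_Ioo fun t ht => ?_
      have h1 := ht.1
      have h2 : 0 < 1 - t := by linarith [ht.2]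
      simp only [F, Real.norm_eq_abs]
      rw [abs_mul, abs_mul (t ^ (ρ - 1)), abs_of_pos (Real.rpow_pos_of_pos h1 _), abs_of_pos (Real.rpow_pos_of_pos h2 _)]
    rw [this, integral_const_mul, key, gco, gco, abs_div, abs_div, abs_mul, abs_mul, abs_mul,
      abs_of_pos (PP_pos hc n), abs_of_pos (PP_pos hb n), abs_of_pos (PP_pos hcρ n)]
    have := (PP_pos hc n).ne'
    have := (PP_pos hcρ n).ne'
    have h2 : |(n.factorial : ℝ)| ≠ 0 := by positivity
    field_simp
  have hs := hasSum_integral_of_summable_integral_norm hFi (by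
    simp only [hN]; exact (summable_gco hcρ h).mul_right K)
  have hT : ∫ t in Ioo (0:ℝ) 1, ∑' n, F n t =
      ∫ t in Ioo (0:ℝ) 1, t ^ (ρ - 1) * (1 - t) ^ (c - 1) * gaussHyp a b c (1 - t) := by
    refine setIntegral_congr_fun measurableSet_Ioo fun t ht => ?_
    have h2 : 0 < 1 - t := by linarith [ht.2]
    rw [gaussHyp, ← tsum_mul_left]
    refine tsum_congr fun n => ?_
    simp only [F, gco]
    rw [show c + n - 1 = (c - 1) + n by ring, Real.rpow_add h2, Real.rpow_natCast]
    ring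
  rw [hT] at hs
  simp only [hI] at hs
  rw [← hs.tsum_eq, tsum_mul_right, gauss_sum hcρ hb hcb h, hK]
  field_simp

noncomputable def phi (a α s : ℝ) : ℝ → ℝ :=
  (Ioo (0:ℝ) 1).indicator (fun u => u ^ (s - 1) * ((1 - u ^ 2) / 2) ^ (2 * α - 1) *
    gaussHyp a α (2 * α) (1 - u ^ 2))

lemma measurable_phi (a : ℝ) {α : ℝ} (s : ℝ) (hα : 0 < α) : Measurable (phi a α s) := by
  have : phi a α s = (Ioo (0:ℝ) 1).indicator (fun u => u ^ (s - 1) *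
      ((1 - u ^ 2) / 2) ^ (2 * α - 1) *
      (Ioo (0:ℝ) 1).indicator (gaussHyp a α (2 * α)) (1 - u ^ 2)) := by
    refine indicator_congr fun u hu => ?_
    have h1 := hu.1
    have h2 := hu.2
    rw [indicator_of_mem]
    constructor <;> nlinarith
  rw [this]
  refine Measurable.indicator ?_ measurableSet_Ioo
  refine Measurable.mul (by fun_prop) ?_
  exact (measurable_hyp a α (c := 2 * α) (by positivity)).comp (by fun_prop)

lemma phi_int {a α s : ℝ} (hα : 0 < α) (hs : 0 < s) (h : 0 < α + s / 2 - a) :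
    ∫ u in Ioi (0:ℝ), phi a α s u = (2:ℝ) ^ (-(2 * α)) * (Real.Gamma (2 * α) * Real.Gamma (s / 2) *
      Real.Gamma (α + s / 2 - a) / (Real.Gamma (2 * α + s / 2 - a) * Real.Gamma (α + s / 2))) := by
  have hJ := J_int (a := a) (b := α) (c := 2 * α) (ρ := s / 2) (by positivity) (by positivity) hα
    (by linarith) (by linarith)
  rw [show 2 * α + s / 2 - a - α = α + s / 2 - a by ring,
    show 2 * α + s / 2 - α = α + s / 2 by ring] at hJ
  rw [← hJ]
  set g : ℝ → ℝ := fun t => t ^ (s / 2 - 1) * (1 - t) ^ (2 * α - 1) * gaussHyp a α (2 * α) (1 - t)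
  have e1 : ∫ t in Ioo (0:ℝ) 1, g t = ∫ t in Ioi (0:ℝ), (Ioo (0:ℝ) 1).indicator g t := by
    rw [setIntegral_indicator measurableSet_Ioo]
    congr 2
    ext x; simp only [mem_inter_iff, mem_Ioo, mem_Ioi]; tauto
  rw [e1, ← integral_comp_rpow_Ioi_of_pos (g := (Ioo (0:ℝ) 1).indicator g) (p := 2) two_pos, ← integral_const_mul]
  refine setIntegral_congr_fun measurableSet_Ioi fun u hu => ?_
  have hu : 0 < u := hu
  simp only [phi, smul_eq_mul, Real.rpow_two]
  by_cases h1 : u < 1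
  · have h2 : 0 < 1 - u ^ 2 := by nlinarith
    rw [indicator_of_mem (show u ∈ Ioo (0:ℝ) 1 from ⟨hu, h1⟩),
      indicator_of_mem (show u ^ 2 ∈ Ioo (0:ℝ) 1 from ⟨by positivity, by linarith⟩)]
    simp only [g]
    rw [Real.div_rpow h2.le zero_le_two, ← Real.rpow_two u, ← Real.rpow_mul hu.le,
      show 2 * α - 1 = -(-(2*α)) - 1 by ring, Real.rpow_sub two_pos, Real.rpow_neg zero_le_two (-(2 * α)),
      show s - 1 = (2 - 1) + 2 * (s / 2 - 1) by ring, Real.rpow_add hu, Real.rpow_one]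
    have : (0:ℝ) < 2 ^ (-(2 * α)) := by positivity
    field_simp
  · rw [indicator_of_notMem (show u ∉ Ioo (0:ℝ) 1 from fun h => h1 h.2),
      indicator_of_notMem (show u ^ 2 ∉ Ioo (0:ℝ) 1 from fun h => h1 (by nlinarith [h.2]))]
    simp

lemma phi_integrable {a α s : ℝ} (hα : 0 < α) (hs : 0 < s) (h : 0 < α + s / 2 - a) :
    IntegrableOn (phi a α s) (Ioi (0:ℝ)) := by
  refine Integrable.of_integral_ne_zero ?_
  rw [phi_int hα hs h]
  have := Real.Gamma_pos_of_pos (show 0 < 2 * α by positivity)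
  have := Real.Gamma_pos_of_pos (half_pos hs)
  have := Real.Gamma_pos_of_pos h
  have := Real.Gamma_pos_of_pos (show 0 < 2 * α + s / 2 - a by linarith)
  have := Real.Gamma_pos_of_pos (show 0 < α + s / 2 by positivity)
  positivity

lemma scale_int (g : ℝ → ℝ) {y : ℝ} (hy : 0 < y) :
    ∫ x in Ioi (0:ℝ), g (x / y) = y * ∫ x in Ioi (0:ℝ), g x := by
  have := integral_comp_mul_right_Ioi g 0 (inv_pos.2 hy)
  simpa [div_eq_mul_inv] using this

lemma pow_f_integrable {f : ℝ → ℝ} (hf : Continuous f) (hsupp : HasCompactSupport f)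
    (hsupp' : tsupport f ⊆ Ioi (0 : ℝ)) (p : ℝ) : Integrable (fun y => y ^ p * f y) := by
  rw [← integrableOn_iff_integrable_of_support_subset (s := tsupport f)]
  · refine ContinuousOn.integrableOn_compact hsupp ?_
    refine ContinuousOn.mul ?_ hf.continuousOn
    exact continuousOn_id.rpow_const fun x hx => Or.inl (hsupp' hx).ne'
  · exact (Function.support_mul_subset_right _ _).trans (subset_tsupport f)

lemma mellin_swap {k f : ℝ → ℝ} {p : ℝ} (hk : Measurable k) (hki : IntegrableOn k (Ioi (0:ℝ)))
    (hf : Continuous f) (hsupp : HasCompactSupport f) (hsupp' : tsupport f ⊆ Ioi (0 : ℝ)) :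
    ∫ x in Ioi (0:ℝ), ∫ y in Ioi (0:ℝ), k (x / y) * (y ^ (p - 1) * f y) =
      (∫ x in Ioi (0:ℝ), k x) * ∫ y in Ioi (0:ℝ), y ^ p * f y := by
  have hy1 : ∀ y : ℝ, 0 < y → y * y ^ (p - 1) = y ^ p := fun y hy => by
    rw [Real.rpow_sub_one hy.ne']; field_simp
  rw [integral_integral_swap, ← integral_const_mul]
  · refine setIntegral_congr_fun measurableSet_Ioi fun y hy => ?_
    have hy : 0 < y := hy
    rw [integral_mul_const, scale_int k hy, ← hy1 y hy]
    ring
  · have hm : Measurable (Function.uncurry fun x y : ℝ => k (x / y) * (y ^ (p - 1) * f y)) := by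
      have := hf.measurable
      unfold Function.uncurry
      fun_prop
    rw [integrable_prod_iff' hm.aestronglyMeasurable]
    constructor
    · refine (ae_restrict_iff' measurableSet_Ioi).2 (Eventually.of_forall fun y hy => ?_)
      change Integrable (fun x => k (x / y) * (y ^ (p - 1) * f y)) _
      refine Integrable.mul_const ?_ _
      have := (integrableOn_Ioi_comp_mul_right_iff k 0 (inv_pos.2 (show 0 < y from hy))).2 (by simpa using hki)
      simpa [div_eq_mul_inv] using! this
    · have h1 := ((pow_f_integrable hf hsupp hsupp' p).norm.integrableOn (s := Ioi (0:ℝ))).const_mul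
        (∫ x in Ioi (0:ℝ), ‖k x‖)
      refine h1.congr ((ae_restrict_iff' measurableSet_Ioi).2 (Eventually.of_forall fun y hy => ?_))
      have hy : 0 < y := hy
      simp only [Function.uncurry, norm_mul]
      rw [integral_mul_const, scale_int (fun x => ‖k x‖) hy, ← hy1 y hy, norm_mul,
        Real.norm_of_nonneg hy.le]
      ring

theorem mellin_IB (ν α : ℝ) (hν : 0 ≤ ν) (hα : 0 < α)
    (f : ℝ → ℝ) (hf : ContDiff ℝ (⊤ : ℕ∞) f) (hsupp : HasCompactSupport f)
    (hsupp' : tsupport f ⊆ Ioi (0 : ℝ))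
    (s : ℝ) (hs : 0 < s) (hs' : ν - 1 < s) :
    mellinT (IB ν α f) s =
      (2 : ℝ) ^ (-(2 * α)) *
        (Real.Gamma (s / 2) * Real.Gamma ((s - ν + 1) / 2)) /
        (Real.Gamma (α + (s - ν + 1) / 2) * Real.Gamma (α + s / 2)) *
        mellinT f (2 * α + s) := by
  set a := α + (ν - 1) / 2 with ha
  have hpos : 0 < α + s / 2 - a := by rw [ha]; linarith
  have hsw := mellin_swap (p := 2 * α + s - 1) (measurable_phi a s hα) (phi_integrable hα hs hpos)
    hf.continuous hsupp hsupp'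
  have hG := Real.Gamma_pos_of_pos (show 0 < 2 * α by positivity)
  have key : mellinT (IB ν α f) s = (1 / Real.Gamma (2 * α)) * ∫ x in Ioi (0:ℝ), ∫ y in Ioi (0:ℝ),
      phi a α s (x / y) * (y ^ (2 * α + s - 1 - 1) * f y) := by
    rw [mellinT, ← integral_const_mul]
    refine setIntegral_congr_fun measurableSet_Ioi fun x hx => ?_
    have hx : 0 < x := hx
    simp only [IB]
    rw [mul_left_comm, ← integral_const_mul]
    congr 1
    symm
    refine (setIntegral_eq_of_subset_of_forall_sdiff_eq_zero measurableSet_Ioi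
      (Ioi_subset_Ioi hx.le) ?_).trans ?_
    rotate_left
    · refine setIntegral_congr_fun measurableSet_Ioi fun y hy => ?_
      have hy : x < y := hy
      have hy0 : 0 < y := hx.trans hy
      have hu : x / y < 1 := (div_lt_one hy0).2 hy
      have hu0 : 0 < x / y := by positivity
      have h2 : 0 < 1 - (x / y) ^ 2 := by nlinarith
      simp only [phi]
      rw [indicator_of_mem (show x / y ∈ Ioo (0:ℝ) 1 from ⟨hu0, hu⟩)]
      have e : (y ^ 2 - x ^ 2) / (2 * y) = y * ((1 - (x / y) ^ 2) / 2) := by field_simp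
      rw [e, Real.mul_rpow hy0.le (by positivity), Real.div_rpow hx.le hy0.le, ← div_pow,
        show 2 * α + s - 1 - 1 = (2 * α - 1) + (s - 1) by ring, Real.rpow_add hy0]
      have h3 : y ^ (s - 1) ≠ 0 := (Real.rpow_pos_of_pos hy0 _).ne'
      generalize y ^ (s - 1) = Y at *
      generalize ((1 - (x / y) ^ 2) / 2) ^ (2 * α - 1) = Z
      generalize gaussHyp a α (2 * α) (1 - (x / y) ^ 2) = W
      field_simp
    · intro y hy
      have hy0 : 0 < y := hy.1
      have : 1 ≤ x / y := (one_le_div hy0).2 (not_lt.1 hy.2)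
      simp only [phi]
      rw [indicator_of_notMem (fun h => this.not_gt h.2), zero_mul]
  rw [key, hsw, phi_int hα hs hpos, mellinT,
    show α + s / 2 - a = (s - ν + 1) / 2 by rw [ha]; ring,
    show 2 * α + s / 2 - a = α + (s - ν + 1) / 2 by rw [ha]; ring]
  field_simp
end

section
/- Let ν ≥ 0, α > 0, set n = ⌊α⌋ + 1, let f : (0,∞) → ℝ be smooth with compact support contained in (0,∞), and let s be a real number with s > 2n and s − 2n > ν − 1. Then the Mellin transform of the fractional Bessel derivative satisfies (DB_{ν,-}^α f)*(s) = 2^{2α} · [Γ(s/2) · Γ((s − ν + 1)/2)] / [Γ((s − 2α − ν + 1)/2) · Γ(s/2 − α)] · f*(s − 2α). -/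
open MeasureTheory Set

/-- Bessel operator B_ν g = g'' + (ν/x) g'. -/
noncomputable def besselOp (ν : ℝ) (g : ℝ → ℝ) (x : ℝ) : ℝ :=
  deriv (deriv g) x + (ν / x) * deriv g x

/-- Fractional Bessel derivative DB_{ν,-}^α f = B_ν^n (IB_{ν,-}^{n-α} f), n = ⌊α⌋ + 1. -/
noncomputable def DB (ν α : ℝ) (f : ℝ → ℝ) : ℝ → ℝ :=
  (besselOp ν)^[Nat.floor α + 1] (IB ν ((Nat.floor α + 1 : ℕ) - α) f)

lemma beta_int_s10 {p q : ℝ} (hp : 0 < p) (hq : 0 < q) :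
    IntegrableOn (fun z : ℝ => z ^ (p - 1) * (1 - z) ^ (q - 1)) (Ioo 0 1) ∧
    ∫ z in Ioo (0:ℝ) 1, z ^ (p - 1) * (1 - z) ^ (q - 1) = ProbabilityTheory.beta p q := by
  have hb := ProbabilityTheory.beta_pos hp hq
  have h1 := ProbabilityTheory.lintegral_betaPDF_eq_one hp hq
  rw [ProbabilityTheory.lintegral_betaPDF] at h1
  have hnn : 0 ≤ᵐ[volume.restrict (Ioo (0:ℝ) 1)]
      (fun x : ℝ => 1 / ProbabilityTheory.beta p q * x ^ (p - 1) * (1 - x) ^ (q - 1)) := by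
    refine ae_restrict_of_forall_mem measurableSet_Ioo (fun x hx ↦ ?_)
    have := hx.1
    have : 0 < 1 - x := by linarith [hx.2]
    simp only [Pi.zero_apply]
    positivity
  have hm : AEStronglyMeasurable (fun x : ℝ => 1 / ProbabilityTheory.beta p q * x ^ (p - 1) * (1 - x) ^ (q - 1)) (volume.restrict (Ioo (0:ℝ) 1)) :=
    Measurable.aestronglyMeasurable (by fun_prop)
  have hi : Integrable (fun x : ℝ => 1 / ProbabilityTheory.beta p q * x ^ (p - 1) * (1 - x) ^ (q - 1)) (volume.restrict (Ioo (0:ℝ) 1)) := by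
    refine ⟨hm, ?_⟩
    rw [hasFiniteIntegral_iff_ofReal hnn, h1]
    simp
  have hv := integral_eq_lintegral_of_nonneg_ae hnn hm
  rw [h1] at hv
  have e : (fun z : ℝ => z ^ (p - 1) * (1 - z) ^ (q - 1)) = fun x => ProbabilityTheory.beta p q * (1 / ProbabilityTheory.beta p q * x ^ (p - 1) * (1 - x) ^ (q - 1)) := by
    ext x; field_simp
  rw [e]
  refine ⟨hi.const_mul _, ?_⟩
  rw [integral_const_mul, hv]; simp

noncomputable def uk (a : ℝ) (k : ℕ) : ℝ := (ascPochhammer ℝ k).eval a / (k.factorial : ℝ)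

lemma uk_eq (a : ℝ) (k : ℕ) : Ring.choose (a + k - 1) k = uk a k := by
  have h := Ring.factorial_nsmul_multichoose_eq_ascPochhammer a k
  have h2 : Ring.choose (a + k - 1) k = Ring.multichoose a k := by
    rw [Ring.choose]; congr 1; ring
  rw [h2, uk, eq_div_iff (by positivity)]
  rw [nsmul_eq_mul, Polynomial.ascPochhammer_smeval_eq_eval] at h
  linarith

lemma binom_hasSum_s10 (a : ℝ) {t : ℝ} (h0 : 0 ≤ t) (h1 : t < 1) :
    HasSum (fun k => uk a k * t ^ k) ((1 - t) ^ (-a)) := by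
  have := (Real.one_div_one_sub_rpow_hasFPowerSeriesOnBall_zero a).hasSum (y := t) (by
    simp only [Metric.mem_eball, edist_zero_right]
    rw [← ofReal_norm, ENNReal.ofReal_lt_one, Real.norm_of_nonneg h0]; exact h1)
  simp only [FormalMultilinearSeries.ofScalars_apply_eq, zero_add, uk_eq, smul_eq_mul] at this
  rw [Real.rpow_neg (by linarith), ← one_div]
  exact this

lemma uk_sum_le {a : ℝ} (ha : -1 < a) {t : ℝ} (h0 : 0 ≤ t) (h1 : t < 1) (N : ℕ) :
    ∑ k ∈ Finset.range N, |uk a k| * t ^ k ≤ 2 + (1 - t) ^ (-a) := by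
  have hb := binom_hasSum_s10 a h0 h1
  have hpos : 0 < (1 - t) ^ (-a) := Real.rpow_pos_of_pos (by linarith) _
  rcases le_or_gt 0 a with h | h
  · have hu : ∀ k, 0 ≤ uk a k := by
      intro k
      refine div_nonneg ?_ (by positivity)
      induction k with
      | zero => simp
      | succ k ih => rw [ascPochhammer_succ_eval]; positivity
    have : ∑ k ∈ Finset.range N, |uk a k| * t ^ k ≤ (1 - t) ^ (-a) := by
      have hb' : HasSum (fun k => |uk a k| * t ^ k) ((1 - t) ^ (-a)) := by
        simpa only [abs_of_nonneg (hu _)] using hb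
      exact sum_le_hasSum _ (fun k _ => by positivity) hb'
    linarith
  · have hu : ∀ k, uk a (k+1) ≤ 0 := by
      intro k
      refine div_nonpos_of_nonpos_of_nonneg ?_ (by positivity)
      induction k with
      | zero => simp [h.le]
      | succ k ih =>
        rw [ascPochhammer_succ_eval]
        refine mul_nonpos_of_nonpos_of_nonneg ih ?_
        push_cast
        have : (0:ℝ) ≤ k := by positivity
        linarith
    have h0' : uk a 0 = 1 := by simp [uk]
    have hs : HasSum (fun k => |uk a k| * t ^ k) (2 - (1 - t) ^ (-a)) := by
      have := (hasSum_ite_eq (0:ℕ) (2:ℝ)).sub hb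
      suffices e : (fun k => |uk a k| * t ^ k) = fun k => (if k = 0 then 2 else 0) - uk a k * t ^ k by
        rw [e]; exact this
      funext k
      cases k with
      | zero => simp [h0']; norm_num
      | succ k => rw [abs_of_nonpos (hu k)]; simp
    have := sum_le_hasSum (Finset.range N) (fun k _ => by positivity) hs
    linarith

lemma uk_beta {a b d : ℝ} (ha : -1 < a) (hb : 0 < b) (hd : 0 < d) (hda : 0 < d - a) :
    Summable (fun k : ℕ => |uk a k| * ProbabilityTheory.beta (b + k) d) ∧
    HasSum (fun k : ℕ => uk a k * ProbabilityTheory.beta (b + k) d)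
      (ProbabilityTheory.beta b (d - a)) := by
  have hi : ∀ k : ℕ, IntegrableOn (fun z : ℝ => z ^ (b + k - 1) * (1 - z) ^ (d - 1)) (Ioo 0 1) :=
    fun k => (beta_int_s10 (by positivity) hd).1
  have hv : ∀ k : ℕ, ∫ z in Ioo (0:ℝ) 1, z ^ (b + k - 1) * (1 - z) ^ (d - 1) = ProbabilityTheory.beta (b + k) d :=
    fun k => (beta_int_s10 (by positivity) hd).2
  have hpow : ∀ (k : ℕ) (z : ℝ), z ∈ Ioo (0:ℝ) 1 → z ^ (b + k - 1) * (1 - z) ^ (d - 1) = z ^ k * (z ^ (b - 1) * (1 - z) ^ (d - 1)) := by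
    intro k z hz
    rw [show b + k - 1 = k + (b - 1) by ring, Real.rpow_add hz.1, Real.rpow_natCast]; ring
  have h1 := beta_int_s10 hb hd
  have h2 := beta_int_s10 hb hda
  have hpow2 : ∀ (z : ℝ), z ∈ Ioo (0:ℝ) 1 → z ^ (b - 1) * (1 - z) ^ (d - a - 1) = (1 - z) ^ (-a) * (z ^ (b - 1) * (1 - z) ^ (d - 1)) := by
    intro z hz
    rw [show d - a - 1 = -a + (d - 1) by ring, Real.rpow_add (by linarith [hz.2])]; ring
  have hS : Summable (fun k : ℕ => |uk a k| * ProbabilityTheory.beta (b + k) d) := by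
    refine summable_of_sum_range_le (c := 2 * ProbabilityTheory.beta b d + ProbabilityTheory.beta b (d - a)) (fun k => mul_nonneg (abs_nonneg _) (ProbabilityTheory.beta_pos (by positivity) hd).le) ?_
    intro N
    simp_rw [← hv, ← integral_const_mul]
    rw [← integral_finsetSum _ (fun k _ => (hi k).const_mul _), ← h1.2, ← h2.2, ← integral_const_mul,
      ← integral_add (h1.1.const_mul _) h2.1]
    refine setIntegral_mono_on (integrable_finsetSum _ (fun k _ => (hi k).const_mul _)) ((h1.1.const_mul _).add h2.1) measurableSet_Ioo ?_
    intro z hz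
    rw [hpow2 z hz, ← add_mul]
    have : ∑ k ∈ Finset.range N, |uk a k| * (z ^ (b + k - 1) * (1 - z) ^ (d - 1)) =
        (∑ k ∈ Finset.range N, |uk a k| * z ^ k) * (z ^ (b - 1) * (1 - z) ^ (d - 1)) := by
      rw [Finset.sum_mul]
      refine Finset.sum_congr rfl fun k _ => ?_
      rw [hpow k z hz]; ring
    rw [this]
    have h3 : 0 < 1 - z := by linarith [hz.2]
    have h4 := hz.1
    exact mul_le_mul_of_nonneg_right (uk_sum_le ha hz.1.le hz.2 N) (by positivity)
  refine ⟨hS, ?_⟩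
  have := hasSum_integral_of_summable_integral_norm (μ := volume.restrict (Ioo (0:ℝ) 1))
    (F := fun k z => uk a k * (z ^ (b + k - 1) * (1 - z) ^ (d - 1))) (fun k => (hi k).const_mul _) (by
      refine hS.congr fun k => ?_
      rw [← hv, ← integral_const_mul]
      refine setIntegral_congr_fun measurableSet_Ioo fun z hz => ?_
      have h3 : 0 < 1 - z := by linarith [hz.2]
      have h4 := hz.1
      show _ = _
      rw [norm_mul, Real.norm_eq_abs, Real.norm_of_nonneg (by positivity)])
  simp_rw [integral_const_mul, hv] at this
  suffices h : ProbabilityTheory.beta b (d - a) = ∫ z in Ioo (0:ℝ) 1, ∑' i : ℕ, uk a i * (z ^ (b + i - 1) * (1 - z) ^ (d - 1)) by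
    rw [h]; exact this
  rw [← h2.2]
  refine setIntegral_congr_fun measurableSet_Ioo fun z hz => ?_
  rw [hpow2 z hz]
  symm
  simp_rw [hpow _ z hz, ← mul_assoc]
  rw [tsum_mul_right, tsum_mul_right, (binom_hasSum_s10 a hz.1.le hz.2).tsum_eq]

lemma integrable_tsum_aux {μ : Measure ℝ} {F : ℕ → ℝ → ℝ}
    (hF_int : ∀ i, Integrable (F i) μ) (hF_sum : Summable fun i ↦ ∫ a, ‖F i a‖ ∂μ) :
    Integrable (fun a => ∑' i, F i a) μ := by
  have hf' : ∑' i, ∫⁻ a, ‖F i a‖ₑ ∂μ ≠ ⊤ := by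
    have : ∀ i, ∫⁻ a, ‖F i a‖ₑ ∂μ = ENNReal.ofReal (∫ a, ‖F i a‖ ∂μ) := fun i =>
      (ofReal_integral_norm_eq_lintegral_enorm (hF_int i)).symm
    simp_rw [this]
    exact hF_sum.tsum_ofReal_ne_top
  refine ⟨?_, ?_⟩
  · have hs : ∀ᵐ a ∂μ, Summable fun n => F n a := by
      have h2 := hf'
      rw [← lintegral_tsum (fun i => (hF_int i).1.enorm)] at h2
      refine (ae_lt_top' (AEMeasurable.tsum fun i => (hF_int i).1.enorm) h2).mono ?_
      intro x hx
      refine Summable.of_norm ?_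
      have := ENNReal.tsum_coe_ne_top_iff_summable_coe.1 hx.ne
      exact this
    refine aestronglyMeasurable_of_tendsto_ae Filter.atTop (f := fun N a => ∑ i ∈ Finset.range N, F i a) ?_ ?_
    · intro N
      exact Finset.aestronglyMeasurable_fun_sum _ fun i _ => (hF_int i).1
    · filter_upwards [hs] with a ha using ha.hasSum.tendsto_sum_nat
  · rw [HasFiniteIntegral]
    refine lt_of_le_of_lt (lintegral_mono fun a => enorm_tsum_le_tsum_enorm) ?_
    rw [lintegral_tsum (fun i => (hF_int i).1.enorm)]
    exact hf'.lt_top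

lemma gamma_poch {b : ℝ} (hb : 0 < b) (k : ℕ) :
    (ascPochhammer ℝ k).eval b = Real.Gamma (b + k) / Real.Gamma b := by
  have := (Real.Gamma_pos_of_pos hb).ne'
  induction k with
  | zero => simp [this]
  | succ k ih =>
    rw [ascPochhammer_succ_eval, ih]
    push_cast
    rw [← add_assoc, Real.Gamma_add_one (by positivity)]
    ring

noncomputable def Wt (ν β σ : ℝ) (z : ℝ) : ℝ :=
  (1 / Real.Gamma (2 * β)) * 2 ^ (-(2 * β)) * (z ^ (2 * β - 1) * (1 - z) ^ (σ / 2 - 1)) *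
    gaussHyp (β + (ν - 1) / 2) β (2 * β) z

lemma Wt_int {ν β σ : ℝ} (hν : 0 ≤ ν) (hβ : 0 < β) (hσ : 0 < σ) (hσ' : ν - 1 < σ) :
    IntegrableOn (Wt ν β σ) (Ioo 0 1) ∧ ∫ z in Ioo (0:ℝ) 1, Wt ν β σ z =
      2 ^ (-(2 * β)) * (Real.Gamma (σ / 2) * Real.Gamma ((σ - ν + 1) / 2)) /
        (Real.Gamma (β + σ / 2) * Real.Gamma (β + (σ - ν + 1) / 2)) := by
  obtain ⟨hS, hH⟩ := uk_beta (a := β + (ν - 1) / 2) (b := β) (d := β + σ / 2) (by linarith) hβ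
    (by positivity) (by linarith)
  set a := β + (ν - 1) / 2 with ha
  set K := (1 / Real.Gamma (2 * β)) * (2:ℝ) ^ (-(2 * β)) with hK
  set c : ℕ → ℝ := fun k => K * ((ascPochhammer ℝ k).eval a * (ascPochhammer ℝ k).eval β /
    ((ascPochhammer ℝ k).eval (2 * β) * (k.factorial : ℝ))) with hc
  set K2 := 2 ^ (-(2 * β)) * Real.Gamma (σ / 2) / (Real.Gamma β * Real.Gamma (β + σ / 2)) with hK2
  have g1 := Real.Gamma_pos_of_pos hβ
  have g2 := Real.Gamma_pos_of_pos (show 0 < 2 * β by positivity)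
  have g3 := Real.Gamma_pos_of_pos (show 0 < σ / 2 by positivity)
  have g4 := Real.Gamma_pos_of_pos (show 0 < β + σ / 2 by positivity)
  have hK2p : 0 < K2 := by positivity
  have hcB : ∀ k : ℕ, c k * ProbabilityTheory.beta (2 * β + k) (σ / 2) =
      K2 * (uk a k * ProbabilityTheory.beta (β + k) (β + σ / 2)) := by
    intro k
    have g5 := Real.Gamma_pos_of_pos (show 0 < 2 * β + k by positivity)
    have g6 := Real.Gamma_pos_of_pos (show 0 < 2 * β + k + σ / 2 by positivity)
    simp only [hc, hK, hK2, uk, ProbabilityTheory.beta]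
    rw [gamma_poch hβ, gamma_poch (show 0 < 2 * β by positivity),
      show β + k + (β + σ / 2) = 2 * β + k + σ / 2 by ring]
    field_simp
  have hi : ∀ k : ℕ, IntegrableOn (fun z : ℝ => z ^ (2 * β + k - 1) * (1 - z) ^ (σ / 2 - 1)) (Ioo 0 1) :=
    fun k => (beta_int_s10 (by positivity) (by positivity)).1
  have hv : ∀ k : ℕ, ∫ z in Ioo (0:ℝ) 1, z ^ (2 * β + k - 1) * (1 - z) ^ (σ / 2 - 1) = ProbabilityTheory.beta (2 * β + k) (σ / 2) :=
    fun k => (beta_int_s10 (by positivity) (by positivity)).2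
  have hW : ∀ z ∈ Ioo (0:ℝ) 1, ∑' k, c k * (z ^ (2 * β + k - 1) * (1 - z) ^ (σ / 2 - 1)) = Wt ν β σ z := by
    intro z hz
    rw [Wt, gaussHyp, ← tsum_mul_left]
    refine tsum_congr fun k => ?_
    rw [show 2 * β + k - 1 = k + (2 * β - 1) by ring, Real.rpow_add hz.1, Real.rpow_natCast]
    simp only [hc, hK]
    ring
  have hSum : Summable fun k => ∫ z in Ioo (0:ℝ) 1, ‖c k * (z ^ (2 * β + k - 1) * (1 - z) ^ (σ / 2 - 1))‖ := by
    refine (hS.mul_left K2).congr fun k => ?_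
    have hbp := ProbabilityTheory.beta_pos (show 0 < β + (k:ℝ) by positivity) (show 0 < β + σ / 2 by positivity)
    have hbp2 := ProbabilityTheory.beta_pos (show 0 < 2 * β + (k:ℝ) by positivity) (show 0 < σ / 2 by positivity)
    have := congrArg abs (hcB k)
    rw [abs_mul (c k), abs_mul K2, abs_mul (uk a k), abs_of_pos hbp, abs_of_pos hbp2, abs_of_pos hK2p] at this
    rw [← this, ← hv, ← integral_const_mul]
    refine setIntegral_congr_fun measurableSet_Ioo fun z hz => ?_
    have h3 : 0 < 1 - z := by linarith [hz.2]
    have h4 := hz.1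
    rw [norm_mul, Real.norm_eq_abs, Real.norm_of_nonneg (by positivity)]
  constructor
  · have := integrable_tsum_aux (μ := volume.restrict (Ioo (0:ℝ) 1)) (fun k => (hi k).const_mul (c k)) hSum
    exact IntegrableOn.congr_fun this hW measurableSet_Ioo
  · have := hasSum_integral_of_summable_integral_norm (μ := volume.restrict (Ioo (0:ℝ) 1)) (fun k => (hi k).const_mul (c k)) hSum
    rw [setIntegral_congr_fun measurableSet_Ioo hW] at this
    simp_rw [integral_const_mul, hv, hcB] at this
    rw [this.unique (hH.mul_left K2), hK2, ProbabilityTheory.beta,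
      show β + σ / 2 - a = (σ - ν + 1) / 2 by rw [ha]; ring]
    field_simp

def Nice (G : ℝ → ℝ) : Prop :=
  ContDiff ℝ (⊤ : ℕ∞) G ∧ ∃ m M : ℝ, 0 < m ∧ ∀ x, x ∉ Icc m M → G x = 0

lemma Nice.mul {G h : ℝ → ℝ} (hG : Nice G) (hh : ContDiffOn ℝ (⊤ : ℕ∞) h (Ioi 0)) :
    Nice (fun x => h x * G x) := by
  obtain ⟨hc, m, M, hm, hz⟩ := hG
  refine ⟨?_, m, M, hm, fun x hx => by simp [hz x hx]⟩
  rw [contDiff_iff_contDiffAt]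
  intro x
  rcases lt_or_ge 0 x with hx | hx
  · exact (hh.contDiffAt (Ioi_mem_nhds hx)).mul hc.contDiffAt
  · have : (fun x => h x * G x) =ᶠ[nhds x] fun _ => 0 := by
      filter_upwards [Iio_mem_nhds (show x < m by linarith)] with y hy
      rw [hz y (fun h => by have := h.1; simp at hy; linarith), mul_zero]
    exact contDiffAt_const.congr_of_eventuallyEq this

lemma Nice.rpow_mul {G : ℝ → ℝ} (hG : Nice G) (p : ℝ) : Nice (fun x => x ^ p * G x) :=
  hG.mul (fun x hx => (Real.contDiffAt_rpow_const_of_ne (ne_of_gt hx)).contDiffWithinAt)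

lemma Nice.cs {G : ℝ → ℝ} (hG : Nice G) : HasCompactSupport G := by
  obtain ⟨hc, m, M, hm, hz⟩ := hG
  exact HasCompactSupport.intro isCompact_Icc hz

lemma Nice.cont {G : ℝ → ℝ} (hG : Nice G) : Continuous G := hG.1.continuous

lemma Nice.int {G : ℝ → ℝ} (hG : Nice G) : Integrable G :=
  hG.cont.integrable_of_hasCompactSupport hG.cs

lemma Nice.deriv {G : ℝ → ℝ} (hG : Nice G) : Nice (deriv G) := by
  have hc0 := hG.1
  obtain ⟨hc, m, M, hm, hz⟩ := hG
  refine ⟨?_, m, M, hm, fun x hx => ?_⟩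
  · exact (contDiff_infty_iff_deriv.1 hc).2
  · have : G =ᶠ[nhds x] fun _ => 0 := by
      filter_upwards [isClosed_Icc.isOpen_compl.mem_nhds hx] with y hy using hz y hy
    rw [this.deriv_eq]; simp

lemma Nice.add {G H : ℝ → ℝ} (hG : Nice G) (hH : Nice H) : Nice (fun x => G x + H x) := by
  obtain ⟨hc, m, M, hm, hz⟩ := hG
  obtain ⟨hc', m', M', hm', hz'⟩ := hH
  refine ⟨hc.add hc', min m m', max M M', lt_min hm hm', fun x hx => ?_⟩
  show G x + H x = 0
  rw [hz, hz', add_zero]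
  · exact fun h => hx ⟨(min_le_right _ _).trans h.1, h.2.trans (le_max_right _ _)⟩
  · exact fun h => hx ⟨(min_le_left _ _).trans h.1, h.2.trans (le_max_left _ _)⟩

lemma Nice.bessel {G : ℝ → ℝ} (hG : Nice G) (ν : ℝ) : Nice (besselOp ν G) := by
  refine hG.deriv.deriv.add (hG.deriv.mul (h := fun x => ν / x) ?_)
  exact contDiffOn_const.div contDiffOn_id (fun x hx => ne_of_gt hx)

lemma Nice.bessel_iter {G : ℝ → ℝ} (hG : Nice G) (ν : ℝ) (n : ℕ) : Nice ((besselOp ν)^[n] G) := by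
  induction n generalizing G with
  | zero => exact hG
  | succ n ih => rw [Function.iterate_succ_apply]; exact ih (hG.bessel ν)

lemma Nice.comp_mul {G : ℝ → ℝ} (hG : Nice G) {l : ℝ} (hl : 0 < l) : Nice (fun x => G (x * l)) := by
  obtain ⟨hc, m, M, hm, hz⟩ := hG
  refine ⟨hc.comp (contDiff_id.mul contDiff_const), m / l, M / l, by positivity, fun x hx => ?_⟩
  refine hz _ fun h => hx ⟨?_, ?_⟩
  · rw [div_le_iff₀ hl]; exact h.1
  · rw [le_div_iff₀ hl]; exact h.2

lemma Nice.bound {G : ℝ → ℝ} (hG : Nice G) (p : ℝ) :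
    ∃ C, 0 ≤ C ∧ ∀ y, 0 < y → y ^ p * |G y| ≤ C := by
  have h := hG.rpow_mul p
  obtain ⟨C, hC⟩ := h.cs.exists_bound_of_continuous h.cont
  refine ⟨C, (norm_nonneg _).trans (hC 0), fun y hy => ?_⟩
  have := hC y
  rwa [Real.norm_eq_abs, abs_mul, abs_of_pos (Real.rpow_pos_of_pos hy p)] at this

lemma Nice.hasDerivAt {G : ℝ → ℝ} (hG : Nice G) (x : ℝ) : HasDerivAt G (_root_.deriv G x) x :=
  (hG.1.differentiable (by simp) x).hasDerivAt

lemma Nice.intM {G : ℝ → ℝ} (hG : Nice G) (s : ℝ) :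
    IntegrableOn (fun x => x ^ s * G x) (Ioi 0) := (hG.rpow_mul s).int.integrableOn

lemma mellin_deriv {G : ℝ → ℝ} (hG : Nice G) (s : ℝ) :
    mellinT (deriv G) s = -(s - 1) * mellinT G (s - 1) := by
  have h := hG.rpow_mul (s - 1)
  have h1 := h.cs.integral_Ioi_deriv_eq (h.1.of_le (by simp)) 0
  have h0 : G 0 = 0 := by
    obtain ⟨hc, m, M, hm, hz⟩ := hG
    exact hz 0 (fun h => by linarith [h.1])
  have h2 : ∀ x ∈ Ioi (0:ℝ), deriv (fun x => x ^ (s - 1) * G x) x =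
      (s - 1) * (x ^ (s - 1 - 1) * G x) + x ^ (s - 1) * deriv G x := by
    intro x hx
    have := (Real.hasDerivAt_rpow_const (p := s - 1) (Or.inl (ne_of_gt hx))).mul (hG.hasDerivAt x)
    rw [HasDerivAt.deriv (f := fun x => x ^ (s - 1) * G x) this]; ring
  rw [setIntegral_congr_fun measurableSet_Ioi h2,
    integral_add ((hG.intM _).const_mul _) (hG.deriv.intM _), integral_const_mul, h0] at h1
  simp only [mul_zero, neg_zero] at h1
  unfold mellinT
  linarith

lemma mellin_bessel {G : ℝ → ℝ} (hG : Nice G) (ν s : ℝ) :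
    mellinT (besselOp ν G) s = (s - 2) * (s - 1 - ν) * mellinT G (s - 2) := by
  have h1 := mellin_deriv hG.deriv s
  have h2 := mellin_deriv hG (s - 1)
  have h3 : mellinT (besselOp ν G) s = mellinT (deriv (deriv G)) s + ν * mellinT (deriv G) (s - 1) := by
    unfold mellinT
    rw [← integral_const_mul, ← integral_add (hG.deriv.deriv.intM _) ((hG.deriv.intM _).const_mul _)]
    refine setIntegral_congr_fun measurableSet_Ioi fun x hx => ?_
    have hx' : x ≠ 0 := ne_of_gt hx
    simp only [besselOp]
    rw [Real.rpow_sub_one hx' (s - 1)]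
    field_simp
  rw [h3, h1, h2, show s - 1 - 1 = s - 2 by ring]
  ring

lemma mellin_bessel_iter (n : ℕ) {G : ℝ → ℝ} (hG : Nice G) (ν s : ℝ) (hs : 2 * (n:ℝ) < s)
    (hs' : ν - 1 < s - 2 * (n:ℝ)) :
    mellinT ((besselOp ν)^[n] G) s =
      4 ^ n * (Real.Gamma (s / 2) * Real.Gamma ((s - ν + 1) / 2)) /
        (Real.Gamma (s / 2 - n) * Real.Gamma ((s - ν + 1) / 2 - n)) * mellinT G (s - 2 * n) := by
  induction n generalizing G with
  | zero =>
    simp only [Nat.cast_zero, mul_zero, sub_zero] at hs hs'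
    have g1 := (Real.Gamma_pos_of_pos (show 0 < s / 2 by linarith)).ne'
    have g2 := (Real.Gamma_pos_of_pos (show 0 < (s - ν + 1) / 2 by linarith)).ne'
    simp [g1, g2]
  | succ n ih =>
    push_cast at hs hs' ⊢
    rw [Function.iterate_succ_apply, ih (hG.bessel ν) (by linarith) (by linarith),
      mellin_bessel hG]
    have p1 : 0 < s / 2 - (n + 1) := by linarith
    have p2 : 0 < (s - ν + 1) / 2 - (n + 1) := by linarith
    have g1 := (Real.Gamma_pos_of_pos p1).ne'
    have g2 := (Real.Gamma_pos_of_pos p2).ne'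
    rw [show s / 2 - n = (s / 2 - (n + 1)) + 1 by ring, Real.Gamma_add_one p1.ne',
      show (s - ν + 1) / 2 - n = ((s - ν + 1) / 2 - (n + 1)) + 1 by ring, Real.Gamma_add_one p2.ne',
      show s - 2 * (n:ℝ) - 2 = s - 2 * (n + 1) by ring]
    have e1 : s - 2 * ((n:ℝ) + 1) = 2 * (s / 2 - (n + 1)) := by ring
    have e2 : s - 2 * (n:ℝ) - 1 - ν = 2 * ((s - ν + 1) / 2 - (n + 1)) := by ring
    have e3 : (s - 2 * ((n:ℝ) + 1)) * (s - 2 * (n:ℝ) - 1 - ν) * mellinT G (s - 2 * (n + 1)) =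
      4 * (s / 2 - (n + 1)) * ((s - ν + 1) / 2 - (n + 1)) * mellinT G (s - 2 * (n + 1)) := by
      rw [e2]; ring
    rw [e3]
    generalize mellinT G (s - 2 * (n + 1)) = X
    have q1 := p1.ne'
    have q2 := p2.ne'
    generalize s / 2 - ((n:ℝ) + 1) = A at *
    generalize (s - ν + 1) / 2 - ((n:ℝ) + 1) = B at *
    field_simp
    ring

noncomputable def lam (z : ℝ) : ℝ := (1 - z) ^ (-(1 / 2) : ℝ)

lemma lam_pos {z : ℝ} (hz : z ∈ Ioo (0:ℝ) 1) : 0 < lam z :=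
  Real.rpow_pos_of_pos (by linarith [hz.2]) _

@[fun_prop]
lemma lam_meas : Measurable lam := by unfold lam; fun_prop

noncomputable def TT (W : ℝ → ℝ) (p : ℝ) (G : ℝ → ℝ) (x : ℝ) : ℝ :=
  ∫ z in Ioo (0:ℝ) 1, W z * (lam z ^ p * G (x * lam z))

lemma TT_meas {W : ℝ → ℝ} (hW : IntegrableOn W (Ioo 0 1)) (p : ℝ) {G : ℝ → ℝ} (hG : Nice G) (x : ℝ) :
    AEStronglyMeasurable (fun z => W z * (lam z ^ p * G (x * lam z))) (volume.restrict (Ioo 0 1)) := by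
  have := hG.cont.measurable
  exact hW.1.mul (Measurable.aestronglyMeasurable (by fun_prop))

lemma TT_bound {G : ℝ → ℝ} {p : ℝ} {C : ℝ} (hC : ∀ y, 0 < y → y ^ p * |G y| ≤ C)
    {x l : ℝ} (hx : 0 < x) (hl : 0 < l) : |l ^ p * G (x * l)| ≤ C * x ^ (-p) := by
  have h := hC (x * l) (by positivity)
  rw [Real.mul_rpow hx.le hl.le] at h
  rw [abs_mul, abs_of_pos (Real.rpow_pos_of_pos hl p), Real.rpow_neg hx.le, ← div_eq_mul_inv,
    le_div_iff₀ (Real.rpow_pos_of_pos hx p)]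
  linarith

lemma TT_int {W : ℝ → ℝ} (hW : IntegrableOn W (Ioo 0 1)) (p : ℝ) {G : ℝ → ℝ} (hG : Nice G) {x : ℝ}
    (hx : 0 < x) :
    IntegrableOn (fun z => W z * (lam z ^ p * G (x * lam z))) (Ioo 0 1) := by
  obtain ⟨C, hC0, hC⟩ := hG.bound p
  refine Integrable.mono' (hW.norm.mul_const (C * x ^ (-p))) (TT_meas hW p hG x) ?_
  refine ae_restrict_of_forall_mem measurableSet_Ioo fun z hz => ?_
  rw [norm_mul]
  exact mul_le_mul_of_nonneg_left (TT_bound hC hx (lam_pos hz)) (norm_nonneg _)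

lemma TT_deriv {W : ℝ → ℝ} (hW : IntegrableOn W (Ioo 0 1)) {p : ℝ} (hp : 0 ≤ p) {G : ℝ → ℝ}
    (hG : Nice G) {x : ℝ} (hx : 0 < x) :
    HasDerivAt (TT W p G) (TT W (p + 1) (deriv G) x) x := by
  obtain ⟨C, hC0, hC⟩ := hG.deriv.bound (p + 1)
  refine (hasDerivAt_integral_of_dominated_loc_of_deriv_le (s := Ioi (x / 2))
    (μ := volume.restrict (Ioo (0:ℝ) 1))
    (F := fun x z => W z * (lam z ^ p * G (x * lam z)))
    (F' := fun x z => W z * (lam z ^ (p + 1) * deriv G (x * lam z)))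
    (bound := fun z => ‖W z‖ * (C * (x / 2) ^ (-(p + 1))))
    (Ioi_mem_nhds (by linarith)) (Filter.Eventually.of_forall fun y => TT_meas hW p hG y)
    (TT_int hW p hG hx) (TT_meas hW (p + 1) hG.deriv x) ?_ (hW.norm.mul_const _) ?_).2
  · refine ae_restrict_of_forall_mem measurableSet_Ioo fun z hz y hy => ?_
    have hy : x / 2 < y := hy
    have hy0 : 0 < y := by linarith
    rw [norm_mul]
    refine mul_le_mul_of_nonneg_left ((TT_bound hC hy0 (lam_pos hz)).trans ?_) (norm_nonneg _)
    refine mul_le_mul_of_nonneg_left ?_ hC0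
    exact Real.rpow_le_rpow_of_nonpos (by linarith) hy.le (by linarith)
  · refine ae_restrict_of_forall_mem measurableSet_Ioo fun z hz y hy => ?_
    have h1 := (hG.hasDerivAt (y * lam z)).comp y ((hasDerivAt_id y).mul_const (lam z))
    have h2 := (h1.const_mul (lam z ^ p)).const_mul (W z)
    rw [Real.rpow_add_one (lam_pos hz).ne']
    have e : W z * (lam z ^ p * lam z * deriv G (y * lam z)) =
        W z * (lam z ^ p * (deriv G (y * lam z) * (1 * lam z))) := by ring
    rw [e]
    exact h2

lemma bessel_TT {W : ℝ → ℝ} (hW : IntegrableOn W (Ioo 0 1)) {p : ℝ} (hp : 0 ≤ p) {G : ℝ → ℝ}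
    (hG : Nice G) (ν : ℝ) {x : ℝ} (hx : 0 < x) :
    besselOp ν (TT W p G) x = TT W (p + 2) (besselOp ν G) x := by
  have h1 : deriv (TT W p G) =ᶠ[nhds x] TT W (p + 1) (deriv G) := by
    filter_upwards [Ioi_mem_nhds hx] with y hy using (TT_deriv hW hp hG hy).deriv
  rw [besselOp, h1.deriv_eq, h1.eq_of_nhds, (TT_deriv hW (by linarith) hG.deriv hx).deriv]
  unfold TT
  rw [show p + 1 + 1 = p + 2 by ring, ← integral_const_mul,
    ← integral_add (TT_int hW _ hG.deriv.deriv hx) ((TT_int hW _ hG.deriv hx).const_mul _)]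
  refine setIntegral_congr_fun measurableSet_Ioo fun z hz => ?_
  have hl := lam_pos hz
  simp only [besselOp]
  rw [show p + 2 = (p + 1) + 1 by ring, Real.rpow_add_one hl.ne' (p + 1)]
  field_simp

lemma bessel_congr {g h : ℝ → ℝ} (ν : ℝ) (H : ∀ x, 0 < x → g x = h x) {x : ℝ} (hx : 0 < x) :
    besselOp ν g x = besselOp ν h x := by
  have h1 : g =ᶠ[nhds x] h := by
    filter_upwards [Ioi_mem_nhds hx] with y hy using H y hy
  rw [besselOp, besselOp, h1.deriv.deriv_eq, h1.deriv_eq]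

lemma bessel_iter_TT {W : ℝ → ℝ} (hW : IntegrableOn W (Ioo 0 1)) (ν : ℝ) (n : ℕ) :
    ∀ {p : ℝ} (_ : 0 ≤ p) {G g : ℝ → ℝ} (_ : Nice G) (_ : ∀ x, 0 < x → g x = TT W p G x)
    {x : ℝ} (_ : 0 < x), (besselOp ν)^[n] g x = TT W (p + 2 * n) ((besselOp ν)^[n] G) x := by
  induction n with
  | zero => intro p hp G g hG hg x hx; simpa using hg x hx
  | succ n ih =>
    intro p hp G g hG hg x hx
    rw [Function.iterate_succ_apply, Function.iterate_succ_apply,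
      ih (p := p + 2) (by linarith) (hG.bessel ν) (fun y hy => ?_) hx]
    · push_cast; congr 1; ring
    · rw [bessel_congr ν hg hy, bessel_TT hW hp hG ν hy]

lemma scale_int_s10 (Q : ℝ → ℝ) (s : ℝ) {l : ℝ} (hl : 0 < l) :
    ∫ x in Ioi (0:ℝ), x ^ (s - 1) * (l ^ s * Q (x * l)) = ∫ x in Ioi (0:ℝ), x ^ (s - 1) * Q x := by
  have h := integral_comp_mul_right_Ioi (fun x => x ^ (s - 1) * Q x) 0 hl
  rw [zero_mul, smul_eq_mul] at h
  rw [eq_comm, inv_mul_eq_div, div_eq_iff hl.ne', mul_comm, ← integral_const_mul] at h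
  rw [h]
  refine setIntegral_congr_fun measurableSet_Ioi fun x hx => ?_
  rw [Real.mul_rpow (le_of_lt hx) hl.le, show l ^ s = l ^ (s - 1) * l by
    rw [← Real.rpow_add_one hl.ne']; congr 1; ring]
  ring

lemma mellin_TT {W : ℝ → ℝ} (hW : IntegrableOn W (Ioo 0 1)) (s : ℝ) {G : ℝ → ℝ} (hG : Nice G) :
    mellinT (TT W s G) s = (∫ z in Ioo (0:ℝ) 1, W z) * mellinT G s := by
  unfold mellinT TT
  have h0 : ∀ x : ℝ, x ^ (s - 1) * ∫ z in Ioo (0:ℝ) 1, W z * (lam z ^ s * G (x * lam z)) =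
      ∫ z in Ioo (0:ℝ) 1, x ^ (s - 1) * (W z * (lam z ^ s * G (x * lam z))) :=
    fun x => (integral_const_mul _ _).symm
  simp_rw [h0]
  rw [integral_integral_swap]
  · rw [← integral_mul_const]
    refine setIntegral_congr_fun measurableSet_Ioo fun z hz => ?_
    rw [← scale_int_s10 G s (lam_pos hz), ← integral_const_mul]
    refine integral_congr_ae (Filter.Eventually.of_forall fun x => ?_)
    simp only; ring
  · have hm := hG.cont.measurable
    rw [integrable_prod_iff']
    · constructor
      · refine ae_restrict_of_forall_mem measurableSet_Ioo fun z hz => ?_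
        have := ((hG.comp_mul (lam_pos hz)).intM (s - 1)).const_mul (W z * lam z ^ s)
        refine this.congr (Filter.Eventually.of_forall fun x => ?_)
        simp only [Function.uncurry]; ring
      · have := hW.norm.mul_const (∫ x in Ioi (0:ℝ), x ^ (s - 1) * |G x|)
        refine IntegrableOn.congr_fun this (fun z hz => ?_) measurableSet_Ioo
        rw [← scale_int_s10 (fun x => |G x|) s (lam_pos hz), ← integral_const_mul]
        refine setIntegral_congr_fun measurableSet_Ioi fun x hx => ?_
        have hx : 0 < x := hx
        simp only [Function.uncurry, norm_mul, Real.norm_eq_abs]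
        rw [abs_of_pos (Real.rpow_pos_of_pos hx _), abs_of_pos (Real.rpow_pos_of_pos (lam_pos hz) _)]
        ring
    · have h1 : AEStronglyMeasurable (fun q : ℝ × ℝ => W q.2)
        ((volume.restrict (Ioi (0:ℝ))).prod (volume.restrict (Ioo (0:ℝ) 1))) := hW.1.comp_snd
      have h2 : Measurable (fun q : ℝ × ℝ => q.1 ^ (s - 1) * (lam q.2 ^ s * G (q.1 * lam q.2))) := by
        fun_prop
      refine (h1.mul h2.aestronglyMeasurable).congr (Filter.Eventually.of_forall fun q => ?_)
      simp only [Function.uncurry, Pi.mul_apply]; ring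

lemma IB_eq_TT (ν β σ : ℝ) (f : ℝ → ℝ) {x : ℝ} (hx : 0 < x) :
    IB ν β f x = TT (Wt ν β σ) σ (fun y => y ^ (2 * β) * f y) x := by
  have himg : (fun y : ℝ => 1 - x ^ 2 / y ^ 2) '' Ioi x = Ioo 0 1 := by
    ext z
    constructor
    · rintro ⟨y, hy, rfl⟩
      have hy : x < y := hy
      have hy0 : 0 < y := hx.trans hy
      have : x ^ 2 / y ^ 2 < 1 := by
        rw [div_lt_one (by positivity)]; nlinarith
      have h2 : 0 < x ^ 2 / y ^ 2 := by positivity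
      exact ⟨by simp only; linarith, by simp only; linarith⟩
    · rintro ⟨h0, h1⟩
      have h3 : 0 < 1 - z := by linarith
      have h4 : 0 < Real.sqrt (1 - z) := Real.sqrt_pos.2 h3
      have h5 : Real.sqrt (1 - z) < 1 := by
        rw [Real.sqrt_lt' one_pos]; linarith
      refine ⟨x / Real.sqrt (1 - z), ?_, ?_⟩
      · show x < _
        rw [lt_div_iff₀ h4]; nlinarith
      · simp only [div_pow, Real.sq_sqrt h3.le]
        field_simp
        ring
  have hinj : InjOn (fun y : ℝ => 1 - x ^ 2 / y ^ 2) (Ioi x) := by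
    intro y hy y' hy' h
    have hy0 : 0 < y := hx.trans hy
    have hy0' : 0 < y' := hx.trans hy'
    simp only [sub_right_inj] at h
    rw [div_eq_div_iff (by positivity) (by positivity)] at h
    have := mul_left_cancel₀ (by positivity : x ^ 2 ≠ 0) h
    exact ((pow_left_inj₀ hy0'.le hy0.le two_ne_zero).1 this).symm
  have hder : ∀ y ∈ Ioi x, HasDerivWithinAt (fun y : ℝ => 1 - x ^ 2 / y ^ 2) (2 * x ^ 2 / y ^ 3) (Ioi x) y := by
    intro y hy
    have hy0 : 0 < y := hx.trans hy
    have := ((hasDerivAt_const y (x ^ 2)).div (hasDerivAt_pow 2 y) (by positivity)).const_sub 1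
    have e : 2 * x ^ 2 / y ^ 3 = -((0 * y ^ 2 - x ^ 2 * (((2:ℕ):ℝ) * y ^ (2 - 1))) / (y ^ 2) ^ 2) := by
      norm_num
      field_simp
    rw [e]
    exact this.hasDerivWithinAt
  unfold TT IB
  rw [← himg, integral_image_eq_integral_abs_deriv_smul measurableSet_Ioi hder hinj, ← integral_const_mul]
  refine setIntegral_congr_fun measurableSet_Ioi fun y hy => ?_
  have hy : x < y := hy
  have hy0 : 0 < y := hx.trans hy
  have hl : lam (1 - x ^ 2 / y ^ 2) = y / x := by
    unfold lam
    rw [sub_sub_cancel, ← div_pow, ← Real.rpow_natCast, ← Real.rpow_mul (by positivity)]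
    norm_num
    rw [Real.rpow_neg_one, inv_div]
  have hxy : x * (y / x) = y := by field_simp
  have hz : 0 < 1 - x ^ 2 / y ^ 2 := by
    have : x ^ 2 / y ^ 2 < 1 := by
      rw [div_lt_one (by positivity)]; nlinarith
    linarith
  simp only [smul_eq_mul]
  rw [hl, hxy, abs_of_pos (by positivity), Wt, sub_sub_cancel]
  have e1 : (x ^ 2 / y ^ 2) ^ (σ / 2 - 1) * (y / x) ^ σ = y ^ 2 / x ^ 2 := by
    rw [← div_pow, ← Real.rpow_natCast, ← Real.rpow_mul (by positivity), ← inv_div x y,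
      Real.inv_rpow (by positivity), ← Real.rpow_neg (by positivity), ← Real.rpow_add (by positivity)]
    push_cast
    rw [show 2 * (σ / 2 - 1) + -σ = -(2:ℝ) by ring, Real.rpow_neg (by positivity)]
    norm_num
    rw [← inv_pow, inv_div, div_pow]
  have e2 : ((y ^ 2 - x ^ 2) / (2 * y)) ^ (2 * β - 1) =
      y ^ (2 * β) / y * (2 ^ (-(2 * β)) * 2) * (1 - x ^ 2 / y ^ 2) ^ (2 * β - 1) := by
    rw [show (y ^ 2 - x ^ 2) / (2 * y) = y * 2⁻¹ * (1 - x ^ 2 / y ^ 2) by field_simp,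
      Real.mul_rpow (by positivity) hz.le, Real.mul_rpow hy0.le (by positivity),
      Real.rpow_sub_one hy0.ne', Real.inv_rpow (by norm_num), ← Real.rpow_neg (by norm_num),
      show -(2 * β - 1) = -(2 * β) + 1 by ring, Real.rpow_add_one (by norm_num)]
  rw [e2]
  generalize gaussHyp (β + (ν - 1) / 2) β (2 * β) (1 - x ^ 2 / y ^ 2) = H
  generalize (1 - x ^ 2 / y ^ 2) ^ (2 * β - 1) = Z
  have e3 : 2 * x ^ 2 / y ^ 3 * (1 / Real.Gamma (2 * β) * 2 ^ (-(2 * β)) * (Z * (x ^ 2 / y ^ 2) ^ (σ / 2 - 1)) * H *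
      ((y / x) ^ σ * (y ^ (2 * β) * f y))) = 2 * x ^ 2 / y ^ 3 * (1 / Real.Gamma (2 * β) * 2 ^ (-(2 * β)) * Z * H *
      (y ^ (2 * β) * f y)) * ((x ^ 2 / y ^ 2) ^ (σ / 2 - 1) * (y / x) ^ σ) := by ring
  rw [e3, e1]
  have := hx.ne'
  have := hy0.ne'
  generalize 1 / Real.Gamma (2 * β) = g
  field_simp

theorem mellin_DB (ν α : ℝ) (hν : 0 ≤ ν) (hα : 0 < α)
    (f : ℝ → ℝ) (hf : ContDiff ℝ (⊤ : ℕ∞) f) (hsupp : HasCompactSupport f)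
    (hsupp' : tsupport f ⊆ Ioi (0 : ℝ))
    (s : ℝ) (hs : 2 * ((Nat.floor α : ℝ) + 1) < s)
    (hs' : ν - 1 < s - 2 * ((Nat.floor α : ℝ) + 1)) :
    mellinT (DB ν α f) s =
      (2 : ℝ) ^ (2 * α) *
        (Real.Gamma (s / 2) * Real.Gamma ((s - ν + 1) / 2)) /
        (Real.Gamma ((s - 2 * α - ν + 1) / 2) * Real.Gamma (s / 2 - α)) *
        mellinT f (s - 2 * α) := by

  set n := Nat.floor α + 1 with hn
  have hnr : ((n : ℕ) : ℝ) = (Nat.floor α : ℝ) + 1 := by rw [hn]; push_cast; rfl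
  rw [← hnr] at hs hs'
  have hlt : α < n := by rw [hnr]; exact Nat.lt_floor_add_one α
  set β : ℝ := n - α with hβd
  have hβ : 0 < β := by linarith
  set σ : ℝ := s - 2 * n with hσd
  have hσ : 0 < σ := by linarith
  obtain ⟨hWi, hWv⟩ := Wt_int hν hβ hσ hs'
  have hNf : Nice f := by
    refine ⟨hf, ?_⟩
    rcases (tsupport f).eq_empty_or_nonempty with he | hne
    · refine ⟨1, 1, one_pos, fun x _ => ?_⟩
      exact image_eq_zero_of_notMem_tsupport (by simp [he])
    · obtain ⟨m, hm, hm'⟩ := hsupp.isCompact.exists_isLeast hne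
      obtain ⟨M, hM, hM'⟩ := hsupp.isCompact.exists_isGreatest hne
      refine ⟨m, M, hsupp' hm, fun x hx => ?_⟩
      exact image_eq_zero_of_notMem_tsupport fun h => hx ⟨hm' h, hM' h⟩
  have hF := hNf.rpow_mul (2 * β)
  have hD : ∀ x ∈ Ioi (0:ℝ), x ^ (s - 1) * DB ν α f x = x ^ (s - 1) *
      TT (Wt ν β σ) s ((besselOp ν)^[n] (fun y => y ^ (2 * β) * f y)) x := by
    intro x hx
    have := bessel_iter_TT hWi ν n hσ.le hF (g := IB ν β f) (fun y hy => IB_eq_TT ν β σ f hy) hx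
    rw [show σ + 2 * n = s by rw [hσd]; ring] at this
    rw [← this]; rfl
  have h1 : mellinT (DB ν α f) s = mellinT (TT (Wt ν β σ) s ((besselOp ν)^[n] (fun y => y ^ (2 * β) * f y))) s :=
    setIntegral_congr_fun measurableSet_Ioi hD
  have h2 : mellinT (fun y => y ^ (2 * β) * f y) (s - 2 * n) = mellinT f (s - 2 * α) := by
    refine setIntegral_congr_fun measurableSet_Ioi fun x hx => ?_
    simp only
    rw [← mul_assoc, ← Real.rpow_add hx]
    congr 2
    rw [hβd]; ring
  rw [h1, mellin_TT hWi s (hF.bessel_iter ν n), mellin_bessel_iter n hF ν s hs hs', h2, hWv,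
    show s / 2 - n = σ / 2 by rw [hσd]; ring,
    show (s - ν + 1) / 2 - n = (σ - ν + 1) / 2 by rw [hσd]; ring,
    show β + σ / 2 = s / 2 - α by rw [hσd, hβd]; ring,
    show β + (σ - ν + 1) / 2 = (s - 2 * α - ν + 1) / 2 by rw [hσd, hβd]; ring]
  have g1 := (Real.Gamma_pos_of_pos (show 0 < σ / 2 by linarith)).ne'
  have g2 := (Real.Gamma_pos_of_pos (show 0 < (σ - ν + 1) / 2 by linarith)).ne'
  have e : (2:ℝ) ^ (2 * α) = 2 ^ (-(2 * β)) * 4 ^ n := by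
    rw [show (4:ℝ) = 2 ^ (2:ℝ) by norm_num, ← Real.rpow_natCast, ← Real.rpow_mul (by norm_num),
      ← Real.rpow_add (by norm_num)]
    congr 1
    rw [hβd]; ring
  rw [e]
  field_simp
end
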